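/- arXiv:1705.02134 — 2 statements merged into one kernel-verified Lean document; each statement's English description precedes it below -/
import Mathlib

section
/- The Eisenstein series E₁ vanishes at the elliptic point: E₁(−1/2 + (√3/6)i) = 0; and the automorphic form κ = 2E₃ − E₁³ vanishes at the point (√3/3)i: 2·E₃((√3/3)i) = E₁((√3/3)i)³. -/
noncomputable section

/-- The quadratic character mod 3 (Legendre symbol `(d/3)`). -/
def chi3 (d : ℕ) : ℤ := if d % 3 = 1 then 1 else if d % 3 = 2 then -1 else 0

/-- The weight-one Eisenstein series for `Γ₁(3)`:
`E₁(τ) = 1 + 6·Σ_{n≥1} (Σ_{d ∣ n} χ(d)) qⁿ` with `q = exp(2πiτ)`. -/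
def E1 (τ : ℂ) : ℂ :=
  1 + 6 * ∑' n : ℕ, (∑ d ∈ n.divisors, (chi3 d : ℂ)) *
    Complex.exp (2 * Real.pi * Complex.I * τ) ^ n

/-- The weight-three Eisenstein series for `Γ₁(3)`:
`E₃(τ) = 1 − 9·Σ_{n≥1} (Σ_{d ∣ n} χ(d)d²) qⁿ`. -/
def E3 (τ : ℂ) : ℂ :=
  1 - 9 * ∑' n : ℕ, (∑ d ∈ n.divisors, (chi3 d : ℂ) * (d : ℂ) ^ 2) *
    Complex.exp (2 * Real.pi * Complex.I * τ) ^ n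

namespace EisensteinThree

open Complex Filter Topology Set

/-- `F` agrees with an analytic function on a punctured neighbourhood of `z`. -/
def HasRemovableSing (F : ℂ → ℂ) (z : ℂ) : Prop :=
  ∃ g, AnalyticAt ℂ g z ∧ F =ᶠ[𝓝[≠] z] g

theorem HasRemovableSing.add_period {F : ℂ → ℂ} {a z : ℂ} (h : HasRemovableSing F z)
    (ha : ∀ w, F (w - a) = F w) : HasRemovableSing F (z + a) := by
  obtain ⟨g, hg, hFg⟩ := h
  refine ⟨fun w => g (w - a), ?_, ?_⟩
  · exact AnalyticAt.fun_comp (by simpa using hg) (by fun_prop)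
  · have ht : Tendsto (fun w : ℂ => w - a) (𝓝[≠] (z + a)) (𝓝[≠] z) := by
      refine tendsto_nhdsWithin_iff.2 ⟨?_, ?_⟩
      · have : ContinuousAt (fun w : ℂ => w - a) (z + a) := by fun_prop
        simpa [ContinuousAt] using this.tendsto.mono_left nhdsWithin_le_nhds
      · filter_upwards [self_mem_nhdsWithin] with w hw hw'
        exact hw (by simp at hw'; simp [← hw'])
    filter_upwards [ht.eventually hFg] with w hw
    rw [← hw, ha]

theorem add_int_mul_period {F : ℂ → ℂ} {a : ℂ} (ha : ∀ w, F (w + a) = F w) (n : ℤ) (w : ℂ) :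
    F (w + n * a) = F w := by
  have h : Function.Periodic F a := ha
  simpa using h.int_mul n w

/-- A doubly periodic function all of whose singularities are removable is constant. -/
theorem exists_eventually_eq_const {F : ℂ → ℂ} {a b : ℂ}
    (hab : ∀ z : ℂ, ∃ s t : ℝ, z = s * a + t * b)
    (ha : ∀ z, F (z + a) = F z) (hb : ∀ z, F (z + b) = F z)
    (hF : ∀ z, HasRemovableSing F z) :
    ∃ c, ∀ z, ∀ᶠ w in 𝓝[≠] z, F w = c := by
  set G : ℂ → ℂ := fun z => limUnder (𝓝[≠] z) F with hG
  have key : ∀ z g, AnalyticAt ℂ g z → F =ᶠ[𝓝[≠] z] g → G z = g z := by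
    intro z g hg h
    exact ((hg.continuousAt.tendsto.mono_left nhdsWithin_le_nhds).congr' h.symm).limUnder_eq
  have loc : ∀ z g, AnalyticAt ℂ g z → F =ᶠ[𝓝[≠] z] g → G =ᶠ[𝓝 z] g := by
    intro z g hg h
    have h1 : ∀ᶠ w in 𝓝[≠] z, F =ᶠ[𝓝 w] g := by
      have := eventually_eventually_nhdsWithin.2 h
      filter_upwards [this, self_mem_nhdsWithin] with w hw hw'
      rwa [(isOpen_compl_singleton.nhdsWithin_eq hw' : 𝓝[{z}ᶜ] w = 𝓝 w)] at hw
    have h2 := eventually_nhdsWithin_iff.1 h1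
    filter_upwards [h2, hg.eventually_analyticAt] with w hw hw'
    by_cases hwz : w = z
    · subst hwz; exact key _ _ hg h
    · exact key _ _ hw' ((hw hwz).filter_mono nhdsWithin_le_nhds)
  have hGd : Differentiable ℂ G := by
    intro z
    obtain ⟨g, hg, h⟩ := hF z
    exact ((loc z g hg h).symm.differentiableAt_iff (𝕜 := ℂ)).1 hg.differentiableAt
  have per : ∀ p, (∀ z, F (z + p) = F z) → ∀ z, G (z + p) = G z := by
    intro p hp z
    obtain ⟨g, hg, h⟩ := hF z
    have hp' : ∀ w, F (w - p) = F w := fun w => by rw [← hp (w - p), sub_add_cancel]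
    rw [key z g hg h]
    have ht : Tendsto (fun w : ℂ => w - p) (𝓝[≠] (z + p)) (𝓝[≠] z) := by
      refine tendsto_nhdsWithin_iff.2 ⟨?_, ?_⟩
      · have : ContinuousAt (fun w : ℂ => w - p) (z + p) := by fun_prop
        simpa [ContinuousAt] using this.tendsto.mono_left nhdsWithin_le_nhds
      · filter_upwards [self_mem_nhdsWithin] with w hw hw'
        exact hw (by simp at hw'; simp [← hw'])
    have := key (z + p) (fun w => g (w - p))
      (AnalyticAt.fun_comp (by simpa using hg) (by fun_prop))
      (by filter_upwards [ht.eventually h] with w hw; rw [← hw, hp'])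
    simpa using this
  have hbd : Bornology.IsBounded (range G) := by
    have hc : IsCompact ((fun p : ℝ × ℝ => (p.1 * a + p.2 * b : ℂ)) '' (Icc 0 1 ×ˢ Icc 0 1)) :=
      (isCompact_Icc.prod isCompact_Icc).image (by fun_prop)
    refine (hc.image hGd.continuous).isBounded.subset ?_
    rintro _ ⟨z, rfl⟩
    obtain ⟨s, t, rfl⟩ := hab z
    refine ⟨_, ⟨(Int.fract s, Int.fract t), ?_, rfl⟩, ?_⟩
    · exact ⟨⟨Int.fract_nonneg _, (Int.fract_lt_one _).le⟩,
        ⟨Int.fract_nonneg _, (Int.fract_lt_one _).le⟩⟩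
    · dsimp only
      rw [← add_int_mul_period (per a ha) ⌊s⌋, ← add_int_mul_period (per b hb) ⌊t⌋]
      congr 1
      have h1 : (s : ℂ) = ⌊s⌋ + (Int.fract s : ℝ) := by
        exact_mod_cast (Int.floor_add_fract s).symm
      have h2 : (t : ℂ) = ⌊t⌋ + (Int.fract t : ℝ) := by
        exact_mod_cast (Int.floor_add_fract t).symm
      conv_rhs => rw [h1, h2]
      ring
  refine ⟨G 0, fun z => ?_⟩
  obtain ⟨g, hg, h⟩ := hF z
  filter_upwards [h, (loc z g hg h).filter_mono nhdsWithin_le_nhds] with w h1 h2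
  rw [h1, ← h2]
  exact hGd.apply_eq_apply_of_bounded hbd _ _

theorem eventually_nhds_of_eventually_nhdsNE {f g : ℂ → ℂ} {z : ℂ} (hf : AnalyticAt ℂ f z)
    (hg : AnalyticAt ℂ g z) (h : ∀ᶠ w in 𝓝[≠] z, f w = g w) : ∀ᶠ w in 𝓝 z, f w = g w :=
  (hf.frequently_eq_iff_eventually_eq hg).1 h.frequently

/-- The function `w / (1 - w)`, with the value `-1/2` at its pole. -/
def geom (w : ℂ) : ℂ := ((1 + w) / (1 - w) - 1) / 2

theorem geom_of_ne {w : ℂ} (hw : w ≠ 1) : geom w = w / (1 - w) := by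
  have : 1 - w ≠ 0 := sub_ne_zero.2 hw.symm
  unfold geom; field_simp; ring

theorem geom_add_inv {w : ℂ} (hw : w ≠ 0) : geom w + geom w⁻¹ = -1 := by
  by_cases h : w = 1
  · subst h; norm_num [geom]
  · have h1 : 1 - w ≠ 0 := sub_ne_zero.2 (Ne.symm h)
    have h2 : w⁻¹ ≠ 1 := by simpa using h
    have h3 : w - 1 ≠ 0 := sub_ne_zero.2 h
    rw [geom_of_ne h, geom_of_ne h2]
    have : w⁻¹ / (1 - w⁻¹) = 1 / (w - 1) := by field_simp
    rw [this, ← neg_sub w 1]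
    field_simp; ring

theorem analyticAt_geom {w : ℂ} (hw : w ≠ 1) : AnalyticAt ℂ geom w := by
  have : 1 - w ≠ 0 := sub_ne_zero.2 hw.symm
  unfold geom
  fun_prop (disch := assumption)

theorem norm_geom_le {w : ℂ} {r : ℝ} (hr : r < 1) (hw : ‖w‖ ≤ r) :
    ‖geom w‖ ≤ ‖w‖ / (1 - r) := by
  have h1 : w ≠ 1 := by rintro rfl; simp at hw; linarith
  rw [geom_of_ne h1, norm_div]
  have h2 : 1 - r ≤ ‖1 - w‖ := by
    have := norm_sub_norm_le (1 : ℂ) w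
    simp at this; linarith
  exact div_le_div_of_nonneg_left (norm_nonneg _) (by linarith) h2

theorem hasSum_geom {w : ℂ} (hw : ‖w‖ < 1) : HasSum (fun n : ℕ => w ^ (n + 1)) (geom w) := by
  have h1 : w ≠ 1 := by rintro rfl; simp at hw
  rw [geom_of_ne h1, div_eq_mul_inv]
  simpa [pow_succ'] using (hasSum_geometric_of_norm_lt_one hw).mul_left w

/-- The Lambert-type series `∑ m, q ^ m w / (1 - q ^ m w)`. -/
def lambert (q w : ℂ) : ℂ := ∑' m : ℕ, geom (q ^ m * w)

theorem norm_pow_mul_le {q w : ℂ} (hq : ‖q‖ < 1) (m : ℕ) : ‖q ^ m * w‖ ≤ ‖w‖ := by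
  rw [norm_mul, norm_pow]
  exact mul_le_of_le_one_left (norm_nonneg _) (pow_le_one₀ (norm_nonneg _) hq.le)

theorem summable_geom_of_lt {q w : ℂ} (hq : ‖q‖ < 1) (hw : ‖w‖ < 1) :
    Summable fun m : ℕ => geom (q ^ m * w) := by
  refine Summable.of_norm_bounded
    (((summable_geometric_of_lt_one (norm_nonneg _) hq).mul_right ‖w‖).div_const (1 - ‖w‖)) ?_
  intro m
  simpa using norm_geom_le hw (norm_pow_mul_le hq m)

theorem exists_norm_pow_mul_lt {q : ℂ} (hq : ‖q‖ < 1) (w : ℂ) : ∃ M : ℕ, ‖q ^ M * w‖ < 1 := by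
  have h : Tendsto (fun M : ℕ => ‖q ^ M * w‖) atTop (𝓝 0) := by
    have := (tendsto_pow_atTop_nhds_zero_of_norm_lt_one hq).mul_const w
    simpa using this.norm
  exact (h.eventually_lt_const one_pos).exists

theorem summable_geom {q : ℂ} (hq : ‖q‖ < 1) (w : ℂ) :
    Summable fun m : ℕ => geom (q ^ m * w) := by
  obtain ⟨M, hM⟩ := exists_norm_pow_mul_lt hq w
  rw [← summable_nat_add_iff M]
  simpa [pow_add, mul_assoc] using summable_geom_of_lt hq hM

theorem lambert_eq {q : ℂ} (hq : ‖q‖ < 1) (w : ℂ) :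
    lambert q w = geom w + lambert q (q * w) := by
  unfold lambert
  rw [(summable_geom hq w).tsum_eq_zero_add]
  simp [pow_succ, mul_assoc]

theorem analyticAt_lambert_of_lt {q w : ℂ} (hq : ‖q‖ < 1) (hw : ‖w‖ < 1) :
    AnalyticAt ℂ (lambert q) w := by
  obtain ⟨r, hr, hr1⟩ := exists_between hw
  have hd : DifferentiableOn ℂ (lambert q) (Metric.ball 0 r) := by
    refine differentiableOn_tsum_of_summable_norm
      (((summable_geometric_of_lt_one (norm_nonneg _) hq).mul_right r).div_const (1 - r))
      ?_ Metric.isOpen_ball ?_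
    · intro m z hz
      have hz' : ‖z‖ < r := by simpa using hz
      have h1 : q ^ m * z ≠ 1 := by
        intro h
        have := norm_pow_mul_le (w := z) hq m
        rw [h] at this; simp at this; linarith
      exact ((analyticAt_geom h1).fun_comp (f := fun z => q ^ m * z)
        (by fun_prop)).differentiableAt.differentiableWithinAt
    · intro m z hz
      have hz' : ‖z‖ < r := by simpa using hz
      refine (norm_geom_le hr1 ((norm_pow_mul_le hq m).trans hz'.le)).trans ?_
      have : 0 < 1 - r := by linarith
      rw [norm_mul, norm_pow]
      gcongr
  exact hd.analyticAt (Metric.isOpen_ball.mem_nhds (by simpa using hr))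

theorem analyticAt_lambert {q w : ℂ} (hq : ‖q‖ < 1) (hw : ∀ m : ℕ, q ^ m * w ≠ 1) :
    AnalyticAt ℂ (lambert q) w := by
  obtain ⟨M, hM⟩ := exists_norm_pow_mul_lt hq w
  induction M generalizing w with
  | zero => exact analyticAt_lambert_of_lt hq (by simpa using hM)
  | succ M ih =>
    have h1 : AnalyticAt ℂ (lambert q) (q * w) :=
      ih (fun m => by simpa [pow_succ, mul_assoc] using hw (m + 1))
        (by simpa [pow_succ, mul_assoc] using hM)
    have h2 : lambert q = fun w => geom w + lambert q (q * w) := funext (lambert_eq hq)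
    rw [h2]
    exact (analyticAt_geom (by simpa using hw 0)).add (h1.fun_comp (by fun_prop))

theorem lambert_eq_tsum {q w : ℂ} (hq : ‖q‖ < 1) (hw : ‖w‖ < 1) :
    lambert q w = ∑' n : ℕ, (1 - q ^ (n + 1))⁻¹ * w ^ (n + 1) := by
  have hs : Summable (Function.uncurry fun m n : ℕ => (q ^ m * w) ^ (n + 1)) := by
    refine Summable.of_norm_bounded
      ((summable_geometric_of_lt_one (norm_nonneg q) hq).mul_of_nonneg
        (summable_geometric_of_lt_one (norm_nonneg w) hw) (fun _ => by positivity)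
        fun _ => by positivity) ?_
    rintro ⟨m, n⟩
    simp only [Function.uncurry_apply_pair, norm_pow, norm_mul, mul_pow]
    gcongr ?_ * ?_
    · exact pow_le_of_le_one (by positivity) (pow_le_one₀ (norm_nonneg _) hq.le) (by simp)
    · exact pow_le_pow_of_le_one (norm_nonneg _) hw.le (by simp)
  have h1 : lambert q w = ∑' m : ℕ, ∑' n : ℕ, (q ^ m * w) ^ (n + 1) :=
    tsum_congr fun m => (hasSum_geom ((norm_pow_mul_le hq m).trans_lt hw)).tsum_eq.symm
  rw [h1, ← hs.tsum_comm]
  refine tsum_congr fun n => ?_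
  have hqn : ‖q ^ (n + 1)‖ < 1 := by
    rw [norm_pow]; exact pow_lt_one₀ (norm_nonneg _) hq (by simp)
  rw [← tsum_geometric_of_norm_lt_one hqn, ← tsum_mul_right]
  refine tsum_congr fun m => ?_
  ring

/-- The properties of the normalised Weierstrass zeta function of the lattice `ℤ + ℤτ` that
has period `1`. -/
structure IsQuasiZeta (τ : ℂ) (Z : ℂ → ℂ) : Prop where
  im_pos : 0 < τ.im
  add_one : ∀ z, Z (z + 1) = Z z
  add_tau : ∀ z, Z (z + τ) = Z z - 2 * Real.pi * I
  neg : ∀ z, Z (-z) = -Z z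
  analyticAt : ∀ z, (∀ m n : ℤ, z ≠ m + n * τ) → AnalyticAt ℂ Z z
  pole : ∃ h, AnalyticAt ℂ h 0 ∧ ∀ᶠ z in 𝓝[≠] 0, Z z = z⁻¹ + h z

/-- The function `e^{2πiz}`. -/
def expTwoPi (z : ℂ) : ℂ := exp (2 * Real.pi * I * z)

theorem expTwoPi_add (z w : ℂ) : expTwoPi (z + w) = expTwoPi z * expTwoPi w := by
  simp [expTwoPi, mul_add, exp_add]

theorem expTwoPi_neg (z : ℂ) : expTwoPi (-z) = (expTwoPi z)⁻¹ := by
  simp [expTwoPi, exp_neg]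

theorem expTwoPi_ne_zero (z : ℂ) : expTwoPi z ≠ 0 := exp_ne_zero _

theorem expTwoPi_nat_mul (n : ℕ) (z : ℂ) : expTwoPi (n * z) = expTwoPi z ^ n := by
  rw [expTwoPi, expTwoPi, ← exp_nat_mul]; congr 1; ring

theorem expTwoPi_eq_one_iff (z : ℂ) : expTwoPi z = 1 ↔ ∃ n : ℤ, z = n := by
  have h : (2 * Real.pi * I : ℂ) ≠ 0 := two_pi_I_ne_zero
  rw [expTwoPi, exp_eq_one_iff]
  refine exists_congr fun n => ?_
  rw [mul_comm (n : ℂ)]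
  exact mul_right_inj' h

theorem expTwoPi_one : expTwoPi 1 = 1 := (expTwoPi_eq_one_iff 1).2 ⟨1, by simp⟩

theorem norm_expTwoPi_lt_one {τ : ℂ} (hτ : 0 < τ.im) : ‖expTwoPi τ‖ < 1 := by
  rw [expTwoPi, norm_exp, Real.exp_lt_one_iff]
  simp
  positivity

theorem hasDerivAt_expTwoPi (z : ℂ) :
    HasDerivAt expTwoPi (2 * Real.pi * I * expTwoPi z) z := by
  have := ((hasDerivAt_id z).const_mul (2 * Real.pi * I : ℂ)).cexp
  refine this.congr_deriv ?_
  simp [expTwoPi, mul_comm]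

theorem analyticAt_expTwoPi (z : ℂ) : AnalyticAt ℂ expTwoPi z := by
  unfold expTwoPi; fun_prop

/-- The Weierstrass zeta function normalised to have period `1`, as a Lambert series. -/
def quasiZeta (τ z : ℂ) : ℂ :=
  -(2 * Real.pi * I) * (1 / 2 + lambert (expTwoPi τ) (expTwoPi z)
    - lambert (expTwoPi τ) (expTwoPi τ * (expTwoPi z)⁻¹))

theorem quasiZeta_eq {τ : ℂ} (hτ : 0 < τ.im) (z : ℂ) : quasiZeta τ z =
    -(2 * Real.pi * I) * (1 / 2 + geom (expTwoPi z)
      + lambert (expTwoPi τ) (expTwoPi τ * expTwoPi z)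
      - lambert (expTwoPi τ) (expTwoPi τ * (expTwoPi z)⁻¹)) := by
  rw [quasiZeta, lambert_eq (norm_expTwoPi_lt_one hτ) (expTwoPi z)]; ring

theorem exists_analyticAt_geom_expTwoPi :
    ∃ h, AnalyticAt ℂ h 0 ∧
      ∀ᶠ z in 𝓝[≠] 0, -(2 * Real.pi * I) * geom (expTwoPi z) = z⁻¹ + h z := by
  set g := dslope expTwoPi 0 with hg
  have hga : AnalyticAt ℂ g 0 := by
    have hd : DifferentiableOn ℂ expTwoPi univ :=
      fun z _ => (hasDerivAt_expTwoPi z).differentiableAt.differentiableWithinAt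
    exact ((differentiableOn_dslope univ_mem).2 hd).analyticAt univ_mem
  have hg0 : g 0 = 2 * Real.pi * I := by
    rw [hg, dslope_same, (hasDerivAt_expTwoPi 0).deriv]; simp [expTwoPi]
  have hg0' : g 0 ≠ 0 := by rw [hg0]; exact two_pi_I_ne_zero
  have hgz : ∀ z, z * g z = expTwoPi z - 1 := by
    intro z
    have := sub_smul_dslope expTwoPi 0 z
    simpa [expTwoPi] using this
  set k : ℂ → ℂ := fun z => 2 * Real.pi * I * expTwoPi z / g z with hk
  have hka : AnalyticAt ℂ k 0 :=
    (analyticAt_const.mul (analyticAt_expTwoPi 0)).div hga hg0'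
  have hk0 : k 0 = 1 := by
    simp only [hk, hg0]; simp [expTwoPi]
  refine ⟨dslope k 0, ?_, ?_⟩
  · obtain ⟨p, hp⟩ := hka
    exact ⟨_, hp.has_fpower_series_dslope_fslope⟩
  · filter_upwards [self_mem_nhdsWithin,
      (hga.continuousAt.eventually_ne hg0').filter_mono nhdsWithin_le_nhds] with z hz hgz0
    have hz : z ≠ 0 := hz
    have h1 : expTwoPi z - 1 ≠ 0 := by rw [← hgz]; exact mul_ne_zero hz hgz0
    rw [geom_of_ne (sub_ne_zero.1 h1), dslope_of_ne _ hz, slope_def_field, hk0]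
    have h2 : 1 - expTwoPi z = -(z * g z) := by rw [hgz]; ring
    rw [h2]
    simp only [hk]
    field_simp
    ring

theorem isQuasiZeta_quasiZeta {τ : ℂ} (hτ : 0 < τ.im) : IsQuasiZeta τ (quasiZeta τ) where
  im_pos := hτ
  add_one z := by simp [quasiZeta, expTwoPi_add, expTwoPi_one]
  add_tau z := by
    have hq := expTwoPi_ne_zero τ
    rw [quasiZeta_eq hτ z, quasiZeta, expTwoPi_add, mul_inv]
    have h1 : expTwoPi τ * ((expTwoPi z)⁻¹ * (expTwoPi τ)⁻¹) = (expTwoPi z)⁻¹ := by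
      field_simp
    rw [h1, lambert_eq (norm_expTwoPi_lt_one hτ) (expTwoPi z)⁻¹,
      mul_comm (expTwoPi z) (expTwoPi τ),
      eq_sub_of_add_eq' (geom_add_inv (expTwoPi_ne_zero z))]
    ring
  neg z := by
    rw [quasiZeta_eq hτ z, quasiZeta, expTwoPi_neg, inv_inv,
      lambert_eq (norm_expTwoPi_lt_one hτ) (expTwoPi z)⁻¹,
      eq_sub_of_add_eq' (geom_add_inv (expTwoPi_ne_zero z))]
    ring
  analyticAt z hz := by
    have hq := norm_expTwoPi_lt_one hτ
    have h0 := expTwoPi_ne_zero z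
    have h1 : AnalyticAt ℂ (lambert (expTwoPi τ)) (expTwoPi z) := by
      refine analyticAt_lambert hq fun m h => ?_
      rw [← expTwoPi_nat_mul, ← expTwoPi_add, expTwoPi_eq_one_iff] at h
      obtain ⟨n, hn⟩ := h
      refine hz n (-m) ?_
      push_cast
      linear_combination hn
    have h2 : AnalyticAt ℂ (lambert (expTwoPi τ)) (expTwoPi τ * (expTwoPi z)⁻¹) := by
      refine analyticAt_lambert hq fun m h => ?_
      rw [← mul_assoc, ← pow_succ, ← expTwoPi_nat_mul, ← expTwoPi_neg, ← expTwoPi_add,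
        expTwoPi_eq_one_iff] at h
      obtain ⟨n, hn⟩ := h
      refine hz (-n) (m + 1) ?_
      push_cast at hn ⊢
      linear_combination -hn
    have h3 : AnalyticAt ℂ (fun z => expTwoPi τ * (expTwoPi z)⁻¹) z :=
      analyticAt_const.mul ((analyticAt_expTwoPi z).fun_inv h0)
    exact analyticAt_const.mul ((analyticAt_const.add
      (h1.fun_comp (analyticAt_expTwoPi z))).sub
      (h2.fun_comp (f := fun z => expTwoPi τ * (expTwoPi z)⁻¹) h3))
  pole := by
    have hq := norm_expTwoPi_lt_one hτ
    obtain ⟨h, hh, heq⟩ := exists_analyticAt_geom_expTwoPi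
    have h0 : expTwoPi 0 = 1 := by simp [expTwoPi]
    refine ⟨fun z => h z - 2 * Real.pi * I * (1 / 2
      + lambert (expTwoPi τ) (expTwoPi τ * expTwoPi z)
      - lambert (expTwoPi τ) (expTwoPi τ * (expTwoPi z)⁻¹)), ?_, ?_⟩
    · have h1 : AnalyticAt ℂ (lambert (expTwoPi τ)) (expTwoPi τ * expTwoPi 0) :=
        analyticAt_lambert_of_lt hq (by simpa [h0] using hq)
      have h2 : AnalyticAt ℂ (lambert (expTwoPi τ)) (expTwoPi τ * (expTwoPi 0)⁻¹) :=
        analyticAt_lambert_of_lt hq (by simpa [h0] using hq)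
      have h3 : AnalyticAt ℂ (fun z => expTwoPi τ * expTwoPi z) 0 :=
        analyticAt_const.mul (analyticAt_expTwoPi 0)
      have h4 : AnalyticAt ℂ (fun z => expTwoPi τ * (expTwoPi z)⁻¹) 0 :=
        analyticAt_const.mul ((analyticAt_expTwoPi 0).fun_inv (expTwoPi_ne_zero 0))
      exact hh.sub (analyticAt_const.mul ((analyticAt_const.add
        (h1.fun_comp (f := fun z => expTwoPi τ * expTwoPi z) h3)).sub
        (h2.fun_comp (f := fun z => expTwoPi τ * (expTwoPi z)⁻¹) h4)))
    · filter_upwards [heq] with z hz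
      rw [quasiZeta_eq hτ]
      linear_combination hz

namespace IsQuasiZeta

variable {τ : ℂ} {Z : ℂ → ℂ}

theorem sub_one (hZ : IsQuasiZeta τ Z) (z : ℂ) : Z (z - 1) = Z z := by
  rw [← hZ.add_one (z - 1), sub_add_cancel]

theorem ne_of_im_eq_zero (hZ : IsQuasiZeta τ Z) {r : ℝ} (hr : ∀ m : ℤ, r ≠ m) (m n : ℤ) :
    (r : ℂ) ≠ m + n * τ := by
  intro h
  have h1 := congrArg Complex.im h
  have h2 := congrArg Complex.re h
  simp [hZ.im_pos.ne'] at h1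
  subst h1
  simp at h2
  exact hr m h2

theorem third_ne (m : ℤ) : (1 / 3 : ℝ) ≠ m := by
  intro h
  have : (1 : ℝ) = ((3 * m : ℤ) : ℝ) := by push_cast; linarith
  have : (1 : ℤ) = 3 * m := by exact_mod_cast this
  omega

theorem analyticAt_third (hZ : IsQuasiZeta τ Z) : AnalyticAt ℂ Z (1 / 3) := by
  refine hZ.analyticAt _ fun m n h => hZ.ne_of_im_eq_zero third_ne m n ?_
  simpa using h

theorem analyticAt_neg_third (hZ : IsQuasiZeta τ Z) : AnalyticAt ℂ Z (-(1 / 3)) := by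
  refine hZ.analyticAt _ fun m n h => hZ.ne_of_im_eq_zero third_ne (-m) (-n) ?_
  push_cast at h ⊢
  linear_combination -h

theorem exists_real_coords (hZ : IsQuasiZeta τ Z) (z : ℂ) : ∃ s t : ℝ, z = s * 1 + t * τ := by
  have := hZ.im_pos.ne'
  refine ⟨z.re - z.im / τ.im * τ.re, z.im / τ.im, ?_⟩
  apply Complex.ext <;> simp
  field_simp

theorem deriv_add_one (hZ : IsQuasiZeta τ Z) (z : ℂ) : deriv Z (z + 1) = deriv Z z := by
  rw [← deriv_comp_add_const, funext hZ.add_one]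

theorem deriv_add_tau (hZ : IsQuasiZeta τ Z) (z : ℂ) : deriv Z (z + τ) = deriv Z z := by
  rw [← deriv_comp_add_const, funext hZ.add_tau]
  simp

theorem deriv_neg (hZ : IsQuasiZeta τ Z) (z : ℂ) : deriv Z (-z) = deriv Z z := by
  have h := deriv_comp_neg Z z
  rw [funext hZ.neg, deriv.fun_neg] at h
  exact (neg_injective h).symm

theorem deriv_deriv_neg (hZ : IsQuasiZeta τ Z) (z : ℂ) :
    deriv (deriv Z) (-z) = -deriv (deriv Z) z := by
  have h := deriv_comp_neg (deriv Z) z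
  rw [funext hZ.deriv_neg] at h
  rw [h, neg_neg]

theorem deriv_deriv_deriv_neg (hZ : IsQuasiZeta τ Z) (z : ℂ) :
    deriv (deriv (deriv Z)) (-z) = deriv (deriv (deriv Z)) z := by
  have h := deriv_comp_neg (deriv (deriv Z)) z
  rw [funext hZ.deriv_deriv_neg, deriv.fun_neg] at h
  exact (neg_injective h).symm

theorem pole_zero (hZ : IsQuasiZeta τ Z) :
    ∃ h, AnalyticAt ℂ h 0 ∧ h 0 = 0 ∧ ∀ᶠ z in 𝓝[≠] 0, Z z = z⁻¹ + h z := by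
  obtain ⟨h, hh, heq⟩ := hZ.pole
  refine ⟨h, hh, ?_, heq⟩
  have hn : Tendsto (fun z : ℂ => -z) (𝓝[≠] 0) (𝓝[≠] 0) := by
    refine tendsto_nhdsWithin_iff.2 ⟨?_, ?_⟩
    · have : ContinuousAt (fun z : ℂ => -z) 0 := by fun_prop
      simpa [ContinuousAt] using this.tendsto.mono_left nhdsWithin_le_nhds
    · filter_upwards [self_mem_nhdsWithin] with w hw
      simpa using hw
  have h1 : ∀ᶠ z in 𝓝[≠] 0, h (-z) = -h z := by
    filter_upwards [heq, hn.eventually heq] with z h1 h2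
    rw [hZ.neg, h1, inv_neg] at h2
    linear_combination -h2
  have h2 : AnalyticAt ℂ (fun z => h (-z)) 0 :=
    AnalyticAt.fun_comp (by simpa using hh) (by fun_prop)
  have h3 := (eventually_nhds_of_eventually_nhdsNE h2 hh.neg h1).self_of_nhds
  simp at h3
  exact self_eq_neg.1 h3

theorem eventually_deriv {h : ℂ → ℂ} (hh : AnalyticAt ℂ h 0)
    (heq : ∀ᶠ z in 𝓝[≠] 0, Z z = z⁻¹ + h z) :
    ∀ᶠ z in 𝓝[≠] 0, deriv Z z = -(z ^ 2)⁻¹ + deriv h z := by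
  have h1 : ∀ᶠ w in 𝓝[≠] (0 : ℂ), Z =ᶠ[𝓝 w] fun z => z⁻¹ + h z := by
    filter_upwards [eventually_eventually_nhdsWithin.2 heq, self_mem_nhdsWithin] with w hw hw'
    rwa [(isOpen_compl_singleton.nhdsWithin_eq hw' : 𝓝[{0}ᶜ] w = 𝓝 w)] at hw
  filter_upwards [h1, hh.eventually_analyticAt.filter_mono nhdsWithin_le_nhds,
    self_mem_nhdsWithin] with w hw hw' hw0
  rw [hw.deriv_eq]
  exact ((hasDerivAt_inv hw0).add hw'.differentiableAt.hasDerivAt).deriv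

/-- An identity of analytic functions near `z` may be differentiated. -/
theorem _root_.EisensteinThree.eventually_deriv_eq {f g f' g' : ℂ → ℂ} {z : ℂ}
    (h : ∀ᶠ w in 𝓝 z, f w = g w) (hf : ∀ᶠ w in 𝓝 z, HasDerivAt f (f' w) w)
    (hg : ∀ᶠ w in 𝓝 z, HasDerivAt g (g' w) w) : ∀ᶠ w in 𝓝 z, f' w = g' w := by
  filter_upwards [h.eventually_nhds, hf, hg] with w h1 h2 h3
  exact (h2.congr_of_eventuallyEq (EventuallyEq.symm h1)).unique h3

/-- The form of the addition theorem with second argument `1/3`. -/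
theorem exists_sq_eq (hZ : IsQuasiZeta τ Z) : ∃ C, ∀ z, ∀ᶠ w in 𝓝[≠] z,
    (Z (w + 1 / 3) - Z w - Z (1 / 3)) ^ 2 + deriv Z w + deriv Z (w + 1 / 3) = C := by
  set F : ℂ → ℂ := fun w =>
    (Z (w + 1 / 3) - Z w - Z (1 / 3)) ^ 2 + deriv Z w + deriv Z (w + 1 / 3) with hFdef
  have hF1 : ∀ z, F (z + 1) = F z := fun z => by
    simp only [hFdef]
    rw [add_right_comm z 1, hZ.add_one, hZ.add_one, hZ.deriv_add_one, hZ.deriv_add_one]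
  have hFτ : ∀ z, F (z + τ) = F z := fun z => by
    simp only [hFdef]
    rw [add_right_comm z τ, hZ.add_tau, hZ.add_tau, hZ.deriv_add_tau, hZ.deriv_add_tau]
    ring
  have hFneg : ∀ z, F (-(1 / 3) - z) = F z := fun z => by
    simp only [hFdef]
    have e1 : -(1 / 3) - z + 1 / 3 = -z := by ring
    have e2 : -(1 / 3) - z = -(z + 1 / 3) := by ring
    rw [e1, e2, hZ.neg, hZ.neg, hZ.deriv_neg, hZ.deriv_neg]
    ring
  have hlat : ∀ (m n : ℤ) z, F (z - (m + n * τ)) = F z := fun m n z => by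
    have := add_int_mul_period hFτ (-n) (z + (-m : ℤ) * 1)
    rw [add_int_mul_period hF1] at this
    rw [← this]; congr 1; push_cast; ring
  have hr0 : HasRemovableSing F 0 := by
    obtain ⟨h, hh, hh0, heq⟩ := hZ.pole_zero
    have hsh : AnalyticAt ℂ (fun w => Z (w + 1 / 3)) 0 :=
      AnalyticAt.fun_comp (by simpa using hZ.analyticAt_third) (by fun_prop)
    have hsh' : AnalyticAt ℂ (fun w => deriv Z (w + 1 / 3)) 0 :=
      AnalyticAt.fun_comp (g := deriv Z) (by simpa using hZ.analyticAt_third.deriv)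
        (by fun_prop)
    set t : ℂ → ℂ := fun w => Z (w + 1 / 3) - Z (1 / 3) - h w with ht
    have hta : AnalyticAt ℂ t 0 := (hsh.sub analyticAt_const).sub hh
    have ht0 : t 0 = 0 := by simp [ht, hh0]
    have hda : AnalyticAt ℂ (dslope t 0) 0 := by
      obtain ⟨p, hp⟩ := hta
      exact ⟨_, hp.has_fpower_series_dslope_fslope⟩
    refine ⟨fun w => t w ^ 2 - 2 * dslope t 0 w + deriv h w + deriv Z (w + 1 / 3), ?_, ?_⟩
    · exact (((hta.pow 2).sub (analyticAt_const.mul hda)).add hh.deriv).add hsh'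
    · filter_upwards [heq, eventually_deriv hh heq, self_mem_nhdsWithin] with w h1 h2 hw
      have hw : w ≠ 0 := hw
      simp only [hFdef]
      rw [h1, h2, dslope_of_ne _ hw, slope_def_field, ht0]
      simp only [ht]
      field_simp
      ring
  refine exists_eventually_eq_const hZ.exists_real_coords hF1 hFτ fun z => ?_
  by_cases h1 : ∃ m n : ℤ, z = m + n * τ
  · obtain ⟨m, n, rfl⟩ := h1
    simpa only [zero_add] using hr0.add_period (hlat m n)
  by_cases h2 : ∃ m n : ℤ, z + 1 / 3 = m + n * τ
  · obtain ⟨m, n, h⟩ := h2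
    have hr1 : HasRemovableSing F (-(1 / 3)) := by
      obtain ⟨g, hg, hgF⟩ := hr0
      refine ⟨fun w => g (-(1 / 3) - w), AnalyticAt.fun_comp (by simpa using hg) (by fun_prop),
        ?_⟩
      have ht : Tendsto (fun w : ℂ => -(1 / 3) - w) (𝓝[≠] (-(1 / 3))) (𝓝[≠] 0) := by
        refine tendsto_nhdsWithin_iff.2 ⟨?_, ?_⟩
        · have : ContinuousAt (fun w : ℂ => -(1 / 3) - w) (-(1 / 3)) := by fun_prop
          simpa [ContinuousAt] using this.tendsto.mono_left nhdsWithin_le_nhds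
        · filter_upwards [self_mem_nhdsWithin] with w hw hw'
          exact hw (sub_eq_zero.1 hw').symm
      filter_upwards [ht.eventually hgF] with w hw
      rw [← hw, hFneg]
    have := hr1.add_period (hlat m n)
    rwa [← h, neg_add_cancel_comm_assoc] at this
  push Not at h1 h2
  have ha := hZ.analyticAt z h1
  have hb : AnalyticAt ℂ (fun w => Z (w + 1 / 3)) z :=
    AnalyticAt.fun_comp (hZ.analyticAt _ h2) (by fun_prop)
  have hb' : AnalyticAt ℂ (fun w => deriv Z (w + 1 / 3)) z :=
    AnalyticAt.fun_comp (g := deriv Z) (hZ.analyticAt _ h2).deriv (by fun_prop)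
  exact ⟨F, ((((hb.sub ha).sub analyticAt_const).pow 2).add ha.deriv).add hb',
    EventuallyEq.rfl⟩

theorem _root_.AnalyticAt.eventually_hasDerivAt {f : ℂ → ℂ} {z : ℂ} (hf : AnalyticAt ℂ f z) :
    ∀ᶠ w in 𝓝 z, HasDerivAt f (deriv f w) w :=
  hf.eventually_analyticAt.mono fun _ h => h.differentiableAt.hasDerivAt

theorem _root_.AnalyticAt.eventually_hasDerivAt_add {f : ℂ → ℂ} {z a : ℂ}
    (hf : AnalyticAt ℂ f (z + a)) :
    ∀ᶠ w in 𝓝 z, HasDerivAt (fun w => f (w + a)) (deriv f (w + a)) w := by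
  have ht : Tendsto (fun w : ℂ => w + a) (𝓝 z) (𝓝 (z + a)) :=
    (continuous_add_const a).tendsto z
  filter_upwards [ht.eventually hf.eventually_hasDerivAt] with w hw
  exact hw.comp_add_const w a

/-- The first and third Taylor coefficients of the addition theorem at the origin, and its
value and second derivative at `1/3`. -/
theorem relations (hZ : IsQuasiZeta τ Z) {h : ℂ → ℂ} (hh : AnalyticAt ℂ h 0) (hh0 : h 0 = 0)
    (heq : ∀ᶠ z in 𝓝[≠] 0, Z z = z⁻¹ + h z) :
    3 * Z (1 / 3) ^ 2 = deriv h 0 - deriv Z (1 / 3) ∧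
    deriv (deriv (deriv Z)) (1 / 3) = -6 * Z (1 / 3) * deriv (deriv Z) (1 / 3) ∧
    6 * (deriv Z (1 / 3) - deriv h 0) ^ 2 + deriv (deriv (deriv Z)) (1 / 3)
      + 5 * deriv (deriv (deriv h)) 0 = 0 := by
  obtain ⟨C, hC⟩ := hZ.exists_sq_eq
  have hu := hZ.analyticAt_third
  have e2 : (1 / 3 : ℂ) + 1 / 3 = -(1 / 3) + 1 := by norm_num
  have hu2 : AnalyticAt ℂ Z (1 / 3 + 1 / 3) := by
    refine hZ.analyticAt _ fun m n h => hZ.ne_of_im_eq_zero (r := -(1 / 3)) ?_ (m - 1) n ?_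
    · intro k hk
      refine third_ne (-k) ?_
      push_cast
      linarith
    · push_cast
      linear_combination h
  have v0 : Z (1 / 3 + 1 / 3) = -Z (1 / 3) := by rw [e2, hZ.add_one, hZ.neg]
  have v1 : deriv Z (1 / 3 + 1 / 3) = deriv Z (1 / 3) := by
    rw [e2, hZ.deriv_add_one, hZ.deriv_neg]
  have per2 : ∀ z, deriv (deriv Z) (z + 1) = deriv (deriv Z) z := fun z => by
    rw [← deriv_comp_add_const, funext hZ.deriv_add_one]
  have per3 : ∀ z, deriv (deriv (deriv Z)) (z + 1) = deriv (deriv (deriv Z)) z := fun z => by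
    rw [← deriv_comp_add_const, funext per2]
  have v2 : deriv (deriv Z) (1 / 3 + 1 / 3) = -deriv (deriv Z) (1 / 3) := by
    rw [e2, per2, hZ.deriv_deriv_neg]
  have v3 : deriv (deriv (deriv Z)) (1 / 3 + 1 / 3) = deriv (deriv (deriv Z)) (1 / 3) := by
    rw [e2, per3, hZ.deriv_deriv_deriv_neg]
  -- the expansion at `1/3`
  have a0 := hu.eventually_hasDerivAt
  have a1 := hu.deriv.eventually_hasDerivAt
  have a2 := hu.deriv.deriv.eventually_hasDerivAt
  have b0 := hu2.eventually_hasDerivAt_add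
  have b1 := hu2.deriv.eventually_hasDerivAt_add
  have b2 := hu2.deriv.deriv.eventually_hasDerivAt_add
  have hb : AnalyticAt ℂ (fun w => Z (w + 1 / 3)) (1 / 3) :=
    AnalyticAt.fun_comp hu2 (by fun_prop)
  have hb' : AnalyticAt ℂ (fun w => deriv Z (w + 1 / 3)) (1 / 3) :=
    AnalyticAt.fun_comp (g := deriv Z) hu2.deriv (by fun_prop)
  have E0 := eventually_nhds_of_eventually_nhdsNE
    (((((hb.sub hu).sub analyticAt_const).pow 2).add hu.deriv).add hb') analyticAt_const
    (hC (1 / 3))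
  have E1 := eventually_deriv_eq E0
    (f' := fun w => 2 * (Z (w + 1 / 3) - Z w - Z (1 / 3)) * (deriv Z (w + 1 / 3) - deriv Z w)
      + deriv (deriv Z) w + deriv (deriv Z) (w + 1 / 3)) (g' := fun _ => 0)
    (by
      filter_upwards [a0, a1, b0, b1] with w a0 a1 b0 b1
      refine (((((b0.sub a0).sub_const (Z (1 / 3))).pow 2).add a1).add b1).congr_deriv ?_
      simp)
    (Eventually.of_forall fun w => hasDerivAt_const w C)
  have E2 := eventually_deriv_eq E1
    (f' := fun w => 2 * (deriv Z (w + 1 / 3) - deriv Z w) * (deriv Z (w + 1 / 3) - deriv Z w)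
      + 2 * (Z (w + 1 / 3) - Z w - Z (1 / 3))
        * (deriv (deriv Z) (w + 1 / 3) - deriv (deriv Z) w)
      + deriv (deriv (deriv Z)) w + deriv (deriv (deriv Z)) (w + 1 / 3)) (g' := fun _ => 0)
    (by
      filter_upwards [a0, a1, a2, b0, b1, b2] with w a0 a1 a2 b0 b1 b2
      exact ((((((b0.sub a0).sub_const (Z (1 / 3))).const_mul 2).mul (b1.sub a1)).add a2).add
        b2))
    (Eventually.of_forall fun w => hasDerivAt_const w 0)
  have r0 := E0.self_of_nhds
  have r2 := E2.self_of_nhds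
  simp only [Pi.pow_apply, Pi.sub_apply, Pi.add_apply, v0, v1, v2, v3] at r0 r2
  -- the expansion at the origin
  have hu0 : AnalyticAt ℂ Z (0 + 1 / 3) := by simpa using hu
  have c0 := hh.eventually_hasDerivAt
  have c1 := hh.deriv.eventually_hasDerivAt
  have c2 := hh.deriv.deriv.eventually_hasDerivAt
  have d0 := hu0.eventually_hasDerivAt_add
  have d1 := hu0.deriv.eventually_hasDerivAt_add
  have d2 := hu0.deriv.deriv.eventually_hasDerivAt_add
  set t : ℂ → ℂ := fun w => Z (w + 1 / 3) - Z (1 / 3) - h w with ht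
  set t1 : ℂ → ℂ := fun w => deriv Z (w + 1 / 3) - deriv h w with ht1
  set t2 : ℂ → ℂ := fun w => deriv (deriv Z) (w + 1 / 3) - deriv (deriv h) w with ht2
  set t3 : ℂ → ℂ := fun w => deriv (deriv (deriv Z)) (w + 1 / 3) - deriv (deriv (deriv h)) w
    with ht3
  have ht0 : t 0 = 0 := by simp [ht, hh0]
  have f0 : ∀ᶠ w in 𝓝 0, HasDerivAt t (t1 w) w := by
    filter_upwards [c0, d0] with w c0 d0
    exact (d0.sub_const _).sub c0
  have f1 : ∀ᶠ w in 𝓝 0, HasDerivAt t1 (t2 w) w := by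
    filter_upwards [c1, d1] with w c1 d1
    exact d1.sub c1
  have f2 : ∀ᶠ w in 𝓝 0, HasDerivAt t2 (t3 w) w := by
    filter_upwards [c2, d2] with w c2 d2
    exact d2.sub c2
  have G0 : ∀ᶠ w in 𝓝 0, w * t w ^ 2 - 2 * t w + w * deriv h w + w * deriv Z (w + 1 / 3)
      = C * w := by
    have := (hC 0).and (heq.and (eventually_deriv hh heq))
    rw [eventually_nhdsWithin_iff] at this
    filter_upwards [this] with w hw
    by_cases hw0 : w = 0
    · subst hw0; simp [ht0]
    · obtain ⟨h1, h2, h3⟩ := hw hw0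
      rw [← h1, h2, h3]
      simp only [ht]
      field_simp
      ring
  have G1 := eventually_deriv_eq G0
    (f' := fun w => t w ^ 2 + w * (2 * t w * t1 w) - 2 * t1 w + deriv h w
      + w * deriv (deriv h) w + deriv Z (w + 1 / 3) + w * deriv (deriv Z) (w + 1 / 3))
    (g' := fun _ => C)
    (by
      filter_upwards [f0, c1, d1] with w f0 c1 d1
      refine (((((hasDerivAt_id w).mul (f0.pow 2)).sub (f0.const_mul 2)).add
        ((hasDerivAt_id w).mul c1)).add ((hasDerivAt_id w).mul d1)).congr_deriv ?_
      simp
      ring)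
    (Eventually.of_forall fun w => by simpa using (hasDerivAt_id w).const_mul C)
  have G2 := eventually_deriv_eq G1
    (f' := fun w => 4 * t w * t1 w + w * (2 * t1 w * t1 w + 2 * t w * t2 w) - 2 * t2 w
      + 2 * deriv (deriv h) w + w * deriv (deriv (deriv h)) w
      + 2 * deriv (deriv Z) (w + 1 / 3) + w * deriv (deriv (deriv Z)) (w + 1 / 3))
    (g' := fun _ => 0)
    (by
      filter_upwards [f0, f1, c1, c2, d1, d2] with w f0 f1 c1 c2 d1 d2
      refine (((((((f0.pow 2).add ((hasDerivAt_id w).mul ((f0.const_mul 2).mul f1))).sub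
        (f1.const_mul 2)).add c1).add ((hasDerivAt_id w).mul c2)).add d1).add
        ((hasDerivAt_id w).mul d2)).congr_deriv ?_
      simp
      ring)
    (Eventually.of_forall fun w => hasDerivAt_const w C)
  have r1 := G1.self_of_nhds
  have c3 := hh.deriv.deriv.deriv.differentiableAt.hasDerivAt
  have d3 := hu0.deriv.deriv.deriv.eventually_hasDerivAt_add.self_of_nhds
  have hid := hasDerivAt_id (0 : ℂ)
  have f0 := f0.self_of_nhds
  have f1 := f1.self_of_nhds
  have f2 := f2.self_of_nhds
  have c2 := c2.self_of_nhds
  have d2 := d2.self_of_nhds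
  have r3 := (((((((((f0.const_mul 4).mul f1).add (hid.mul
    ((((f1.const_mul 2).mul f1)).add ((f0.const_mul 2).mul f2)))).sub (f2.const_mul 2)).add
    (c2.const_mul 2)).add (hid.mul c3)).add (d2.const_mul 2)).add
    (hid.mul d3)).congr_of_eventuallyEq (EventuallyEq.symm G2)).unique (hasDerivAt_const 0 0)
  simp [ht0, ht1, ht3] at r1 r3
  norm_num at r0 r1 r2 r3 ⊢
  refine ⟨?_, ?_, ?_⟩
  · linear_combination (1 / 3) * (r0 - r1)
  · linear_combination (1 / 2) * r2
  · linear_combination r3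

theorem add_lattice (hZ : IsQuasiZeta τ Z) (m n : ℤ) (z : ℂ) :
    Z (z + (m + n * τ)) = Z z - n * (2 * Real.pi * I) := by
  have hτ : τ ≠ 0 := by rintro rfl; simpa using hZ.im_pos
  have hper : ∀ w, Z (w + τ) + 2 * Real.pi * I * (w + τ) / τ
      = Z w + 2 * Real.pi * I * w / τ := fun w => by
    rw [hZ.add_tau]; field_simp; ring
  have h := add_int_mul_period (F := fun z => Z z + 2 * Real.pi * I * z / τ) hper n z
  rw [add_comm (m : ℂ), ← add_assoc, ← mul_one (m : ℂ), add_int_mul_period hZ.add_one]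
  have h' : 2 * Real.pi * I * (z + n * τ) / τ
      = 2 * Real.pi * I * z / τ + n * (2 * Real.pi * I) := by field_simp
  simp only [h'] at h
  linear_combination h

theorem hasRemovableSing_add_lattice {F : ℂ → ℂ} {a b z : ℂ} (ha : ∀ w, F (w + a) = F w)
    (hb : ∀ w, F (w + b) = F w) (h : HasRemovableSing F z) (m n : ℤ) :
    HasRemovableSing F (z + (m * a + n * b)) := by
  refine h.add_period fun w => ?_
  rw [← add_int_mul_period ha m, ← add_int_mul_period hb n]
  congr 1; ring

theorem _root_.AnalyticAt.fun_comp_const_mul {f : ℂ → ℂ} {r z : ℂ}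
    (hf : AnalyticAt ℂ f (r * z)) : AnalyticAt ℂ (fun w => f (r * w)) z :=
  AnalyticAt.fun_comp (f := fun w => r * w) hf (by fun_prop)

theorem tendsto_const_mul_nhdsNE {r : ℂ} (hr : r ≠ 0) :
    Tendsto (fun z : ℂ => r * z) (𝓝[≠] 0) (𝓝[≠] 0) := by
  refine tendsto_nhdsWithin_iff.2 ⟨?_, ?_⟩
  · have : ContinuousAt (fun z : ℂ => r * z) 0 := by fun_prop
    simpa [ContinuousAt] using this.tendsto.mono_left nhdsWithin_le_nhds
  · filter_upwards [self_mem_nhdsWithin] with w hw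
    exact mul_ne_zero hr hw

/-- The case of a lattice stable under multiplication by a primitive cube root of unity
that fixes `1/3` modulo the lattice. -/
theorem third_eq_zero_of_cube_root (hZ : IsQuasiZeta τ Z)
    (hτ : 3 * τ ^ 2 + 3 * τ + 1 = 0) : Z (1 / 3) = 0 := by
  set ω := 3 * τ + 1 with hωdef
  have hω3 : ω * ω ^ 2 = 1 := by rw [hωdef]; linear_combination 9 * τ * hτ
  have hω0 : ω ≠ 0 := by rintro h; simp [h] at hω3
  set A : ℂ := -(6 * Real.pi * I) * ω with hA
  set F : ℂ → ℂ := fun z => ω * Z (ω * z) - Z z - A * z with hF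
  have hF1 : ∀ z, F (z + 1) = F z := fun z => by
    have e : ω * (z + 1) = ω * z + ((1 : ℤ) + (3 : ℤ) * τ) := by
      rw [hωdef]; push_cast; ring
    simp only [hF]
    rw [e, hZ.add_lattice, hZ.add_one, hA]
    push_cast; ring
  have hFτ : ∀ z, F (z + τ) = F z := fun z => by
    have e : ω * (z + τ) = ω * z + ((-1 : ℤ) + (-2 : ℤ) * τ) := by
      rw [hωdef]; push_cast; linear_combination hτ
    simp only [hF]
    rw [e, hZ.add_lattice, hZ.add_tau, hA, hωdef]
    push_cast
    linear_combination (6 * Real.pi * I) * hτ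
  obtain ⟨h, hh, hh0, heq⟩ := hZ.pole_zero
  have hωh : AnalyticAt ℂ (fun z => h (ω * z)) 0 :=
    AnalyticAt.fun_comp_const_mul (by simpa using hh)
  have hg : AnalyticAt ℂ (fun z => ω * h (ω * z) - h z - A * z) 0 :=
    ((analyticAt_const.mul hωh).sub hh).sub (analyticAt_const.mul analyticAt_id)
  have hFg : F =ᶠ[𝓝[≠] 0] fun z => ω * h (ω * z) - h z - A * z := by
    filter_upwards [heq, (tendsto_const_mul_nhdsNE hω0).eventually heq] with z h1 h2
    simp only [hF]
    rw [h1, h2, mul_inv]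
    field_simp
    ring
  have hreg : ∀ z, (∀ m n : ℤ, z ≠ m + n * τ) → AnalyticAt ℂ F z := by
    intro z hz
    have h1 : AnalyticAt ℂ Z (ω * z) := by
      refine hZ.analyticAt _ fun m n hmn => hz (-2 * m + n) (-3 * m + n) ?_
      have : z = ω ^ 2 * (ω * z) := by linear_combination -z * hω3
      rw [this, hmn, hωdef]
      push_cast
      linear_combination (3 * m + 3 * n * τ - n) * hτ
    exact ((analyticAt_const.mul h1.fun_comp_const_mul).sub (hZ.analyticAt z hz)).sub
      (analyticAt_const.mul analyticAt_id)
  obtain ⟨c, hc⟩ := exists_eventually_eq_const hZ.exists_real_coords hF1 hFτ fun z => by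
    by_cases hz : ∃ m n : ℤ, z = m + n * τ
    · obtain ⟨m, n, rfl⟩ := hz
      simpa only [zero_add, mul_one] using
        hasRemovableSing_add_lattice hF1 hFτ ⟨_, hg, hFg⟩ m n
    · push Not at hz
      exact ⟨F, hreg z hz, EventuallyEq.rfl⟩
  have c0 := (eventually_nhds_of_eventually_nhdsNE hg analyticAt_const
    (by filter_upwards [hc 0, hFg] with w h1 h2; rw [← h2, h1])).self_of_nhds
  have c1 := (eventually_nhds_of_eventually_nhdsNE
    (hreg (1 / 3) fun m n h => hZ.ne_of_im_eq_zero third_ne m n (by simpa using h))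
    analyticAt_const (hc (1 / 3))).self_of_nhds
  have e : ω * (1 / 3) = 1 / 3 + τ := by rw [hωdef]; ring
  simp only [hF] at c1
  rw [e, hZ.add_tau] at c1
  simp [hh0] at c0
  rw [← c0, hA] at c1
  have h3 : (ω - 1) * Z (1 / 3) = 0 := by linear_combination c1
  refine (mul_eq_zero.1 h3).resolve_left ?_
  have hτ0 : τ ≠ 0 := by rintro rfl; simpa using hZ.im_pos
  simpa [hωdef] using hτ0

theorem _root_.AnalyticAt.eventually_hasDerivAt_const_mul {f : ℂ → ℂ} {r : ℂ}
    (hf : AnalyticAt ℂ f 0) :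
    ∀ᶠ w in 𝓝 0, HasDerivAt (fun w => f (r * w)) (r * deriv f (r * w)) w := by
  have ht : Tendsto (fun w : ℂ => r * w) (𝓝 0) (𝓝 0) := by
    simpa using (continuous_const_mul r).tendsto 0
  filter_upwards [ht.eventually hf.eventually_hasDerivAt] with w hw
  have h1 : HasDerivAt (fun w : ℂ => r * w) r w := by
    simpa using (hasDerivAt_id w).const_mul r
  exact (hw.comp w h1).congr_deriv (mul_comm _ _)

/-- The case of a lattice with multiplication by `√-3 = 3τ`, whose kernel is generated
by `1/3`. -/
theorem deriv_deriv_deriv_third (hZ : IsQuasiZeta τ Z) (hτ : 3 * τ ^ 2 + 1 = 0) {h : ℂ → ℂ}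
    (hh : AnalyticAt ℂ h 0) (heq : ∀ᶠ z in 𝓝[≠] 0, Z z = z⁻¹ + h z) :
    deriv (deriv (deriv Z)) (1 / 3) = 4 * deriv (deriv (deriv h)) 0 := by
  have hτ0 : τ ≠ 0 := by rintro rfl; simpa using hZ.im_pos
  set r := 3 * τ with hr
  have hr0 : r ≠ 0 := by simpa [hr] using hτ0
  have hr2 : r ^ 2 = -3 := by rw [hr]; linear_combination 3 * hτ
  set A : ℂ := -(6 * Real.pi * I) * r with hA
  set F : ℂ → ℂ := fun z =>
    r * Z (r * z) - Z z - Z (z + 1 / 3) - Z (z + -(1 / 3)) - A * z with hF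
  have hF1 : ∀ z, F (z + 1 / 3) = F z := fun z => by
    have e1 : r * (z + 1 / 3) = r * z + τ := by rw [hr]; ring
    have e2 : z + 1 / 3 + 1 / 3 = z + -(1 / 3) + 1 := by ring
    have e3 : z + 1 / 3 + -(1 / 3) = z := by ring
    simp only [hF]
    rw [e1, e2, e3, hZ.add_tau, hZ.add_one, hA]
    ring
  have hFτ : ∀ z, F (z + τ) = F z := fun z => by
    have e : r * (z + τ) = r * z - 1 := by rw [hr]; linear_combination hτ
    simp only [hF]
    rw [e, hZ.sub_one, add_right_comm z τ, add_right_comm z τ, hZ.add_tau, hZ.add_tau,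
      hZ.add_tau, hA, hr]
    linear_combination (6 * Real.pi * I) * hτ
  have hu : AnalyticAt ℂ Z (0 + 1 / 3) := by simpa using hZ.analyticAt_third
  have hv : AnalyticAt ℂ Z (0 + -(1 / 3)) := by simpa using hZ.analyticAt_neg_third
  have hg : AnalyticAt ℂ
      (fun z => r * h (r * z) - h z - Z (z + 1 / 3) - Z (z + -(1 / 3)) - A * z) 0 := by
    have h1 : AnalyticAt ℂ (fun z => h (r * z)) 0 :=
      AnalyticAt.fun_comp_const_mul (by simpa using hh)
    exact ((((analyticAt_const.mul h1).sub hh).sub (hu.fun_comp (f := fun z => z + 1 / 3)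
      (by fun_prop))).sub (hv.fun_comp (f := fun z => z + -(1 / 3)) (by fun_prop))).sub
      (analyticAt_const.mul analyticAt_id)
  have hFg : F =ᶠ[𝓝[≠] 0]
      fun z => r * h (r * z) - h z - Z (z + 1 / 3) - Z (z + -(1 / 3)) - A * z := by
    filter_upwards [heq, (tendsto_const_mul_nhdsNE hr0).eventually heq] with z h1 h2
    simp only [hF]
    rw [h1, h2, mul_inv]
    field_simp
    ring
  obtain ⟨c, hc⟩ := exists_eventually_eq_const (a := 1 / 3) (fun z => by
      obtain ⟨s, t, hst⟩ := hZ.exists_real_coords z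
      exact ⟨3 * s, t, by rw [hst]; push_cast; ring⟩) hF1 hFτ fun z => by
    by_cases hz : ∃ m n : ℤ, z = m * (1 / 3) + n * τ
    · obtain ⟨m, n, rfl⟩ := hz
      simpa only [zero_add] using hasRemovableSing_add_lattice hF1 hFτ ⟨_, hg, hFg⟩ m n
    · push Not at hz
      refine ⟨F, ?_, EventuallyEq.rfl⟩
      have h1 : AnalyticAt ℂ Z (r * z) := by
        refine hZ.analyticAt _ fun m n hmn => hz n (-m) ?_
        push_cast
        rw [hr] at hmn
        linear_combination z * hτ - τ * hmn - (n / 3 : ℂ) * hτ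
      have h2 : AnalyticAt ℂ Z z := by
        refine hZ.analyticAt _ fun m n hmn => hz (3 * m) n ?_
        rw [hmn]; push_cast; ring
      have h3 : AnalyticAt ℂ Z (z + 1 / 3) := by
        refine hZ.analyticAt _ fun m n hmn => hz (3 * m - 1) n ?_
        push_cast; linear_combination hmn
      have h4 : AnalyticAt ℂ Z (z + -(1 / 3)) := by
        refine hZ.analyticAt _ fun m n hmn => hz (3 * m + 1) n ?_
        push_cast; linear_combination hmn
      exact ((((analyticAt_const.mul h1.fun_comp_const_mul).sub h2).sub
        (h3.fun_comp (f := fun z => z + 1 / 3) (by fun_prop))).sub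
        (h4.fun_comp (f := fun z => z + -(1 / 3)) (by fun_prop))).sub
        (analyticAt_const.mul analyticAt_id)
  have E0 := eventually_nhds_of_eventually_nhdsNE hg analyticAt_const
    (by filter_upwards [hc 0, hFg] with w h1 h2; rw [← h2, h1])
  have E1 := eventually_deriv_eq E0
    (f' := fun w => r * (r * deriv h (r * w)) - deriv h w - deriv Z (w + 1 / 3)
      - deriv Z (w + -(1 / 3)) - A) (g' := fun _ => 0)
    (by
      filter_upwards [hh.eventually_hasDerivAt_const_mul (r := r), hh.eventually_hasDerivAt,
        hu.eventually_hasDerivAt_add, hv.eventually_hasDerivAt_add] with w h1 h2 h3 h4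
      have h5 : HasDerivAt (fun w : ℂ => A * w) A w := by
        simpa using (hasDerivAt_id w).const_mul A
      exact ((((h1.const_mul r).sub h2).sub h3).sub h4).sub h5)
    (Eventually.of_forall fun w => hasDerivAt_const w c)
  have E2 := eventually_deriv_eq E1
    (f' := fun w => r * (r * (r * deriv (deriv h) (r * w))) - deriv (deriv h) w
      - deriv (deriv Z) (w + 1 / 3) - deriv (deriv Z) (w + -(1 / 3))) (g' := fun _ => 0)
    (by
      filter_upwards [hh.deriv.eventually_hasDerivAt_const_mul (r := r),
        hh.deriv.eventually_hasDerivAt, hu.deriv.eventually_hasDerivAt_add,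
        hv.deriv.eventually_hasDerivAt_add] with w h1 h2 h3 h4
      exact (((((h1.const_mul r).const_mul r).sub h2).sub h3).sub h4).sub_const A)
    (Eventually.of_forall fun w => hasDerivAt_const w 0)
  have E3 := (eventually_deriv_eq E2
    (f' := fun w => r * (r * (r * (r * deriv (deriv (deriv h)) (r * w))))
      - deriv (deriv (deriv h)) w - deriv (deriv (deriv Z)) (w + 1 / 3)
      - deriv (deriv (deriv Z)) (w + -(1 / 3))) (g' := fun _ => 0)
    (by
      filter_upwards [hh.deriv.deriv.eventually_hasDerivAt_const_mul (r := r),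
        hh.deriv.deriv.eventually_hasDerivAt, hu.deriv.deriv.eventually_hasDerivAt_add,
        hv.deriv.deriv.eventually_hasDerivAt_add] with w h1 h2 h3 h4
      exact ((((((h1.const_mul r).const_mul r).const_mul r).sub h2).sub h3).sub h4))
    (Eventually.of_forall fun w => hasDerivAt_const w 0)).self_of_nhds
  rw [zero_add, zero_add, hZ.deriv_deriv_deriv_neg, mul_zero] at E3
  linear_combination (-1 / 2) * E3
    + (r ^ 2 - 3) / 2 * deriv (deriv (deriv h)) 0 * hr2

theorem deriv_deriv_third (hZ : IsQuasiZeta τ Z) (hτ : 3 * τ ^ 2 + 1 = 0)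
    (hs : Z (1 / 3) ≠ 0) : deriv (deriv Z) (1 / 3) = 4 * Z (1 / 3) ^ 3 := by
  obtain ⟨h, hh, hh0, heq⟩ := hZ.pole_zero
  obtain ⟨h1, h2, h3⟩ := hZ.relations hh hh0 heq
  have h4 := hZ.deriv_deriv_deriv_third hτ hh heq
  have h5 : deriv Z (1 / 3) - deriv h 0 = -3 * Z (1 / 3) ^ 2 := by linear_combination h1
  rw [h5] at h3
  have h6 : Z (1 / 3) * (deriv (deriv Z) (1 / 3) - 4 * Z (1 / 3) ^ 3) = 0 := by
    linear_combination (1 / 6) * h2 - (2 / 27) * h3 - (5 / 54) * h4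
  exact sub_eq_zero.1 ((mul_eq_zero.1 h6).resolve_left hs)

end IsQuasiZeta

/-- The Lambert-type series `∑ n ≥ 1, n ^ k w ^ n / (1 - q ^ n)`. -/
def lambertPow (q : ℂ) (k : ℕ) (w : ℂ) : ℂ :=
  ∑' n : ℕ, (1 - q ^ (n + 1))⁻¹ * ((n + 1 : ℕ) : ℂ) ^ k * w ^ (n + 1)

theorem norm_inv_one_sub_pow_le {q : ℂ} (hq : ‖q‖ < 1) (n : ℕ) :
    ‖(1 - q ^ (n + 1))⁻¹‖ ≤ (1 - ‖q‖)⁻¹ := by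
  rw [norm_inv]
  have h1 : ‖q ^ (n + 1)‖ ≤ ‖q‖ := by
    rw [norm_pow]; exact pow_le_of_le_one (norm_nonneg _) hq.le (by simp)
  have h2 := norm_sub_norm_le (1 : ℂ) (q ^ (n + 1))
  rw [norm_one] at h2
  exact inv_anti₀ (by linarith) (by linarith)

theorem summable_succ_pow_mul_pow (k : ℕ) {r : ℝ} (hr0 : 0 ≤ r) (hr : r < 1) :
    Summable fun n : ℕ => ((n + 1 : ℕ) : ℝ) ^ k * r ^ (n + 1) :=
  (summable_nat_add_iff (f := fun n : ℕ => (n : ℝ) ^ k * r ^ n) 1).2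
    (summable_pow_mul_geometric_of_norm_lt_one k (by rwa [Real.norm_of_nonneg hr0]))

theorem summable_lambertPow {q w : ℂ} (hq : ‖q‖ < 1) (k : ℕ) (hw : ‖w‖ < 1) :
    Summable fun n : ℕ => (1 - q ^ (n + 1))⁻¹ * ((n + 1 : ℕ) : ℂ) ^ k * w ^ (n + 1) := by
  refine Summable.of_norm_bounded
    ((summable_succ_pow_mul_pow k (norm_nonneg w) hw).mul_left (1 - ‖q‖)⁻¹) fun n => ?_
  rw [norm_mul, norm_mul, norm_pow, norm_pow, Complex.norm_natCast, mul_assoc]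
  gcongr
  exact norm_inv_one_sub_pow_le hq n

theorem hasDerivAt_lambertPow {q w : ℂ} (hq : ‖q‖ < 1) (k : ℕ) (hw : ‖w‖ < 1) (hw0 : w ≠ 0) :
    HasDerivAt (lambertPow q k) (lambertPow q (k + 1) w / w) w := by
  obtain ⟨r, hr, hr1⟩ := exists_between hw
  have hr0 : 0 < r := (norm_nonneg w).trans_lt hr
  have hu : Summable fun n : ℕ => (1 - ‖q‖)⁻¹ * ((n + 1 : ℕ) : ℝ) ^ (k + 1) * r ^ n := by
    refine (((summable_succ_pow_mul_pow (k + 1) hr0.le hr1).mul_left (1 - ‖q‖)⁻¹).mul_right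
      r⁻¹).congr fun n => ?_
    rw [pow_succ r, ← mul_assoc, ← mul_assoc, mul_inv_cancel_right₀ hr0.ne']
  have key : HasDerivAt (lambertPow q k)
      (∑' n : ℕ, (1 - q ^ (n + 1))⁻¹ * ((n + 1 : ℕ) : ℂ) ^ (k + 1) * w ^ n) w := by
    have hg : ∀ (n : ℕ), ∀ y ∈ Metric.ball (0 : ℂ) r, HasDerivAt
        (fun y => (1 - q ^ (n + 1))⁻¹ * ((n + 1 : ℕ) : ℂ) ^ k * y ^ (n + 1))
        ((1 - q ^ (n + 1))⁻¹ * ((n + 1 : ℕ) : ℂ) ^ (k + 1) * y ^ n) y := by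
      intro n y _
      refine ((hasDerivAt_pow (n + 1) y).const_mul _).congr_deriv ?_
      rw [Nat.add_sub_cancel]
      ring
    refine hasDerivAt_tsum_of_isPreconnected hu
      Metric.isOpen_ball (convex_ball 0 r).isPreconnected hg (fun n y hy => ?_)
      (mem_ball_zero_iff.2 hr) (summable_lambertPow hq k hw) (mem_ball_zero_iff.2 hr)
    have hy : ‖y‖ < r := by simpa using hy
    rw [norm_mul, norm_mul, norm_pow, norm_pow, Complex.norm_natCast]
    have := norm_inv_one_sub_pow_le hq n
    gcongr
  refine key.congr_deriv ?_
  rw [lambertPow, ← tsum_div_const]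
  refine tsum_congr fun n => ?_
  rw [pow_succ w, ← mul_assoc, mul_div_cancel_right₀ _ hw0]

theorem hasDerivAt_lambertPow_mul_expTwoPi {q c z : ℂ} (hq : ‖q‖ < 1) (k : ℕ) (hc : c ≠ 0)
    (hz : ‖c * expTwoPi z‖ < 1) :
    HasDerivAt (fun z => lambertPow q k (c * expTwoPi z))
      (2 * Real.pi * I * lambertPow q (k + 1) (c * expTwoPi z)) z := by
  have h0 : expTwoPi z ≠ 0 := expTwoPi_ne_zero z
  refine ((hasDerivAt_lambertPow hq k hz (mul_ne_zero hc h0)).comp z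
    ((hasDerivAt_expTwoPi z).const_mul c)).congr_deriv ?_
  field_simp

set_option maxHeartbeats 800000 in
theorem tsum_lambert_eq_tsum_divisors {q : ℂ} (hq : ‖q‖ < 1) (k : ℕ) {c : ℕ → ℂ}
    (hc : ∀ n, ‖c n‖ ≤ 1) :
    ∑' n : ℕ, (1 - q ^ (n + 1))⁻¹ * ((n + 1 : ℕ) : ℂ) ^ k * (c (n + 1) * q ^ (n + 1)) =
      ∑' N : ℕ, (∑ d ∈ N.divisors, c d * (d : ℂ) ^ k) * q ^ N := by
  set F : ℕ → ℕ → ℂ := fun a b => c b * (b : ℂ) ^ k * q ^ (a * b) with hF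
  have hs : Summable fun p : ℕ+ × ℕ+ => F p.1 p.2 := by
    refine Summable.of_norm_bounded (summable_prod_mul_pow k hq).norm fun p => ?_
    simp only [hF, norm_mul]
    gcongr
    exact mul_le_of_le_one_left (norm_nonneg _) (hc _)
  have hR : ∑' N : ℕ, (∑ d ∈ N.divisors, c d * (d : ℂ) ^ k) * q ^ N =
      ∑' p : ℕ+ × ℕ+, F p.1 p.2 := by
    have hs' : Summable fun x => F (sigmaAntidiagonalEquivProd x).1
        (sigmaAntidiagonalEquivProd x).2 := sigmaAntidiagonalEquivProd.summable_iff.2 hs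
    rw [← sigmaAntidiagonalEquivProd.tsum_eq, Summable.tsum_sigma hs',
      ← tsum_pnat_eq_tsum_of_eq_zero
        (f := fun N : ℕ => (∑ d ∈ N.divisors, c d * (d : ℂ) ^ k) * q ^ N) (by simp)]
    refine tsum_congr fun N => ?_
    rw [tsum_fintype]
    simp only [sigmaAntidiagonalEquivProd, divisorsAntidiagonalFactors, Equiv.coe_fn_mk,
      PNat.mk_coe, Finset.univ_eq_attach]
    rw [(N : ℕ).divisorsAntidiagonal.sum_attach fun x : ℕ × ℕ => F x.1 x.2,
      Nat.sum_divisorsAntidiagonal' F, Finset.sum_mul]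
    refine Finset.sum_congr rfl fun i hi => ?_
    simp only [hF]
    rw [Nat.div_mul_cancel (Nat.dvd_of_mem_divisors hi)]
  have hs' : Summable fun p : ℕ+ × ℕ+ => F p.2 p.1 := (Equiv.prodComm ℕ+ ℕ+).summable_iff.2 hs
  rw [hR, ← (Equiv.prodComm ℕ+ ℕ+).tsum_eq]
  simp only [Equiv.prodComm_apply, Prod.fst_swap, Prod.snd_swap]
  rw [hs'.tsum_prod,
    ← tsum_pnat_eq_tsum_succ (f := fun n : ℕ =>
      (1 - q ^ n)⁻¹ * (n : ℂ) ^ k * (c n * q ^ n))]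
  refine tsum_congr fun b => ?_
  have hqb : ‖q ^ (b : ℕ)‖ < 1 := by
    rw [norm_pow]; exact pow_lt_one₀ (norm_nonneg _) hq b.ne_zero
  rw [tsum_pnat_eq_tsum_succ (f := fun a : ℕ => F a b),
    ← tsum_geometric_of_norm_lt_one hqb, ← tsum_mul_right, ← tsum_mul_right]
  refine tsum_congr fun a => ?_
  simp only [hF]
  ring

theorem lambert_eq_lambertPow {q w : ℂ} (hq : ‖q‖ < 1) (hw : ‖w‖ < 1) :
    lambert q w = lambertPow q 0 w := by
  simp [lambert_eq_tsum hq hw, lambertPow]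

theorem hasDerivAt_geom_expTwoPi {z : ℂ} (hz : expTwoPi z ≠ 1) :
    HasDerivAt (fun z => geom (expTwoPi z))
      (2 * Real.pi * I * (expTwoPi z / (1 - expTwoPi z) ^ 2)) z := by
  have h1 : 1 - expTwoPi z ≠ 0 := sub_ne_zero.2 hz.symm
  have he := hasDerivAt_expTwoPi z
  refine (((((he.const_add 1).div (he.const_sub 1) h1).sub_const 1).div_const 2)).congr_deriv ?_
  field_simp
  ring

theorem hasDerivAt_div_one_sub_sq_expTwoPi {z : ℂ} (hz : expTwoPi z ≠ 1) :
    HasDerivAt (fun z => expTwoPi z / (1 - expTwoPi z) ^ 2)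
      (2 * Real.pi * I * (expTwoPi z * (1 + expTwoPi z) / (1 - expTwoPi z) ^ 3)) z := by
  have h1 : 1 - expTwoPi z ≠ 0 := sub_ne_zero.2 hz.symm
  have he := hasDerivAt_expTwoPi z
  have hp : HasDerivAt (fun z => (1 - expTwoPi z) ^ 2)
      (2 * (1 - expTwoPi z) * -(2 * Real.pi * I * expTwoPi z)) z := by
    simpa using (he.const_sub 1).fun_pow 2
  refine (he.fun_div hp (pow_ne_zero 2 h1)).congr_deriv ?_
  field_simp
  ring

/-- The points at which the Lambert series defining `quasiZeta` can be differentiated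
termwise. -/
def IsTermwise (τ z : ℂ) : Prop :=
  expTwoPi z ≠ 1 ∧ ‖expTwoPi τ * expTwoPi z‖ < 1 ∧ ‖expTwoPi τ * expTwoPi (-z)‖ < 1

theorem IsTermwise.eventually {τ z : ℂ} (h : IsTermwise τ z) : ∀ᶠ w in 𝓝 z, IsTermwise τ w := by
  have hc : Continuous expTwoPi :=
    continuous_iff_continuousAt.2 fun z => (hasDerivAt_expTwoPi z).continuousAt
  refine (hc.continuousAt.eventually_ne h.1).and (.and ?_ ?_)
  · exact ContinuousAt.eventually_lt (by fun_prop) continuousAt_const h.2.1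
  · exact ContinuousAt.eventually_lt (by fun_prop) continuousAt_const h.2.2

theorem IsTermwise.quasiZeta_eq {τ z : ℂ} (hτ : 0 < τ.im) (h : IsTermwise τ z) :
    quasiZeta τ z = -(2 * Real.pi * I) * (1 / 2 + geom (expTwoPi z)
      + lambertPow (expTwoPi τ) 0 (expTwoPi τ * expTwoPi z)
      - lambertPow (expTwoPi τ) 0 (expTwoPi τ * expTwoPi (-z))) := by
  have hq := norm_expTwoPi_lt_one hτ
  rw [EisensteinThree.quasiZeta_eq hτ, ← expTwoPi_neg, lambert_eq_lambertPow hq h.2.1,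
    lambert_eq_lambertPow hq h.2.2]

theorem hasDerivAt_lambertPow_mul_expTwoPi_neg {q c z : ℂ} (hq : ‖q‖ < 1) (k : ℕ) (hc : c ≠ 0)
    (hz : ‖c * expTwoPi (-z)‖ < 1) :
    HasDerivAt (fun z => lambertPow q k (c * expTwoPi (-z)))
      (-(2 * Real.pi * I * lambertPow q (k + 1) (c * expTwoPi (-z)))) z := by
  refine ((hasDerivAt_lambertPow_mul_expTwoPi hq k hc hz).comp z
    (hasDerivAt_neg z)).congr_deriv ?_
  ring

theorem IsTermwise.hasDerivAt_quasiZeta {τ z : ℂ} (hτ : 0 < τ.im) (h : IsTermwise τ z) :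
    HasDerivAt (quasiZeta τ) (-(2 * Real.pi * I) ^ 2 * (expTwoPi z / (1 - expTwoPi z) ^ 2
      + lambertPow (expTwoPi τ) 1 (expTwoPi τ * expTwoPi z)
      + lambertPow (expTwoPi τ) 1 (expTwoPi τ * expTwoPi (-z)))) z := by
  have hq := norm_expTwoPi_lt_one hτ
  have hc := expTwoPi_ne_zero τ
  refine HasDerivAt.congr_of_eventuallyEq ?_ (h.eventually.mono fun w hw => hw.quasiZeta_eq hτ)
  refine (((((hasDerivAt_geom_expTwoPi h.1).const_add _).add
    (hasDerivAt_lambertPow_mul_expTwoPi hq 0 hc h.2.1)).sub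
    (hasDerivAt_lambertPow_mul_expTwoPi_neg hq 0 hc h.2.2)).const_mul _).congr_deriv ?_
  ring

theorem IsTermwise.deriv_deriv_quasiZeta {τ z : ℂ} (hτ : 0 < τ.im) (h : IsTermwise τ z) :
    deriv (deriv (quasiZeta τ)) z =
      -(2 * Real.pi * I) ^ 3 * (expTwoPi z * (1 + expTwoPi z) / (1 - expTwoPi z) ^ 3
      + lambertPow (expTwoPi τ) 2 (expTwoPi τ * expTwoPi z)
      - lambertPow (expTwoPi τ) 2 (expTwoPi τ * expTwoPi (-z))) := by
  have hq := norm_expTwoPi_lt_one hτ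
  have hc := expTwoPi_ne_zero τ
  refine HasDerivAt.deriv (HasDerivAt.congr_of_eventuallyEq ?_
    (h.eventually.mono fun w hw => (hw.hasDerivAt_quasiZeta hτ).deriv))
  refine ((((hasDerivAt_div_one_sub_sq_expTwoPi h.1).add
    (hasDerivAt_lambertPow_mul_expTwoPi hq 1 hc h.2.1)).add
    (hasDerivAt_lambertPow_mul_expTwoPi_neg hq 1 hc h.2.2)).const_mul _).congr_deriv ?_
  ring

theorem expTwoPi_third : expTwoPi (1 / 3) ^ 2 + expTwoPi (1 / 3) + 1 = 0 := by
  have h1 : expTwoPi (1 / 3) ^ 3 = 1 := by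
    rw [← expTwoPi_nat_mul]; norm_num [expTwoPi_one]
  have h2 : expTwoPi (1 / 3) ≠ 1 := by
    rw [Ne, expTwoPi_eq_one_iff]
    rintro ⟨n, hn⟩
    have h : ((3 * n : ℤ) : ℂ) = (1 : ℤ) := by push_cast; rw [← hn]; norm_num
    have := Int.cast_injective h
    omega
  refine (mul_eq_zero.1 ?_).resolve_left (sub_ne_zero.2 h2)
  linear_combination h1

theorem norm_expTwoPi_of_im_eq_zero {z : ℂ} (hz : z.im = 0) : ‖expTwoPi z‖ = 1 := by
  rw [expTwoPi, norm_exp]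
  simp [hz]

theorem isTermwise_third {τ : ℂ} (hτ : 0 < τ.im) : IsTermwise τ (1 / 3) := by
  have hq := norm_expTwoPi_lt_one hτ
  refine ⟨fun h => ?_, ?_, ?_⟩
  · have := expTwoPi_third
    norm_num [h] at this
  · rwa [norm_mul, norm_expTwoPi_of_im_eq_zero (z := 1 / 3) (by norm_num), mul_one]
  · rwa [norm_mul, norm_expTwoPi_of_im_eq_zero (z := -(1 / 3)) (by norm_num), mul_one]

theorem pow_sub_inv_pow_eq_chi3 {ζ : ℂ} (hζ : ζ ^ 2 + ζ + 1 = 0) (n : ℕ) :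
    ζ ^ n - ζ⁻¹ ^ n = (ζ - ζ⁻¹) * chi3 n := by
  have h3 : ζ ^ 3 = 1 := by linear_combination (ζ - 1) * hζ
  have hi : ζ⁻¹ = ζ ^ 2 := by
    refine inv_eq_of_mul_eq_one_right ?_
    linear_combination h3
  have hi3 : ζ⁻¹ ^ 3 = 1 := by rw [inv_pow, h3, inv_one]
  rw [pow_eq_pow_mod n h3, pow_eq_pow_mod n hi3, chi3]
  have : n % 3 < 3 := Nat.mod_lt _ (by norm_num)
  interval_cases n % 3
  · simp
  · simp
  · simp only [hi]
    norm_num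
    linear_combination ζ * h3

theorem norm_chi3_le (n : ℕ) : ‖(chi3 n : ℂ)‖ ≤ 1 := by
  unfold chi3
  split_ifs <;> simp

theorem lambertPow_sub_lambertPow {q ζ : ℂ} (hq : ‖q‖ < 1) (hζ : ζ ^ 2 + ζ + 1 = 0)
    (hζ1 : ‖ζ‖ = 1) (k : ℕ) :
    lambertPow q k (q * ζ) - lambertPow q k (q * ζ⁻¹) =
      (ζ - ζ⁻¹) * ∑' n : ℕ, (1 - q ^ (n + 1))⁻¹ * ((n + 1 : ℕ) : ℂ) ^ k *
        ((chi3 (n + 1) : ℂ) * q ^ (n + 1)) := by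
  rw [lambertPow, lambertPow, ← (summable_lambertPow hq k ?_).tsum_sub
    (summable_lambertPow hq k ?_), ← tsum_mul_left]
  · refine tsum_congr fun n => ?_
    rw [mul_pow, mul_pow]
    linear_combination (1 - q ^ (n + 1))⁻¹ * ((n + 1 : ℕ) : ℂ) ^ k * q ^ (n + 1) *
      pow_sub_inv_pow_eq_chi3 hζ (n + 1)
  · rwa [norm_mul, hζ1, mul_one]
  · rwa [norm_mul, norm_inv, hζ1, inv_one, mul_one]

theorem E1_eq {τ : ℂ} (hτ : 0 < τ.im) :
    E1 τ = 1 + 6 * ∑' n : ℕ, (1 - expTwoPi τ ^ (n + 1))⁻¹ *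
      ((chi3 (n + 1) : ℂ) * expTwoPi τ ^ (n + 1)) := by
  have := tsum_lambert_eq_tsum_divisors (norm_expTwoPi_lt_one hτ) 0 norm_chi3_le
  simp only [pow_zero, mul_one] at this
  rw [this]
  rfl

theorem E3_eq {τ : ℂ} (hτ : 0 < τ.im) :
    E3 τ = 1 - 9 * ∑' n : ℕ, (1 - expTwoPi τ ^ (n + 1))⁻¹ * ((n + 1 : ℕ) : ℂ) ^ 2 *
      ((chi3 (n + 1) : ℂ) * expTwoPi τ ^ (n + 1)) := by
  rw [tsum_lambert_eq_tsum_divisors (norm_expTwoPi_lt_one hτ) 2 norm_chi3_le]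
  rfl

/-- The constant `πi / √-3`. -/
def scale : ℂ := Real.pi * I / (expTwoPi (1 / 3) - (expTwoPi (1 / 3))⁻¹)

theorem sq_expTwoPi_third_sub_inv : (expTwoPi (1 / 3) - (expTwoPi (1 / 3))⁻¹) ^ 2 = -3 := by
  have h0 := expTwoPi_ne_zero (1 / 3)
  have h := expTwoPi_third
  field_simp
  linear_combination (expTwoPi (1 / 3) ^ 2 - expTwoPi (1 / 3) + 1) * h

theorem expTwoPi_third_sub_inv_ne_zero : expTwoPi (1 / 3) - (expTwoPi (1 / 3))⁻¹ ≠ 0 := by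
  intro h
  have := sq_expTwoPi_third_sub_inv
  norm_num [h] at this

theorem scale_ne_zero : scale ≠ 0 :=
  div_ne_zero (mul_ne_zero (by exact_mod_cast Real.pi_ne_zero) I_ne_zero)
    expTwoPi_third_sub_inv_ne_zero

theorem quasiZeta_third {τ : ℂ} (hτ : 0 < τ.im) : quasiZeta τ (1 / 3) = scale * E1 τ := by
  have hδ := expTwoPi_third_sub_inv_ne_zero
  have hδ2 := sq_expTwoPi_third_sub_inv
  have h1 := (isTermwise_third hτ).1
  have hL := lambertPow_sub_lambertPow (norm_expTwoPi_lt_one hτ) expTwoPi_third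
    (norm_expTwoPi_of_im_eq_zero (by norm_num)) 0
  simp only [pow_zero, mul_one] at hL
  have hg : (1 / 2 + geom (expTwoPi (1 / 3))) * (expTwoPi (1 / 3) - (expTwoPi (1 / 3))⁻¹)
      = -1 / 2 := by
    have h0 := expTwoPi_ne_zero (1 / 3)
    have h2 : 1 - expTwoPi (1 / 3) ≠ 0 := sub_ne_zero.2 h1.symm
    rw [geom]
    field_simp
    linear_combination (expTwoPi (1 / 3) - 1) * expTwoPi_third
  rw [(isTermwise_third hτ).quasiZeta_eq hτ, add_sub_assoc, expTwoPi_neg, hL, E1_eq hτ, scale]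
  generalize expTwoPi (1 / 3) - (expTwoPi (1 / 3))⁻¹ = δ at *
  rw [div_mul_eq_mul_div, eq_div_iff hδ]
  linear_combination (-(2 * Real.pi * I)) * hg - 2 * Real.pi * I * (∑' n : ℕ,
    (1 - expTwoPi τ ^ (n + 1))⁻¹ * ((chi3 (n + 1) : ℂ) * expTwoPi τ ^ (n + 1))) * hδ2

theorem deriv_deriv_quasiZeta_third {τ : ℂ} (hτ : 0 < τ.im) :
    deriv (deriv (quasiZeta τ)) (1 / 3) = 8 * scale ^ 3 * E3 τ := by
  have hδ := expTwoPi_third_sub_inv_ne_zero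
  have hδ2 := sq_expTwoPi_third_sub_inv
  have h1 := (isTermwise_third hτ).1
  have hL := lambertPow_sub_lambertPow (norm_expTwoPi_lt_one hτ) expTwoPi_third
    (norm_expTwoPi_of_im_eq_zero (by norm_num)) 2
  have hg : expTwoPi (1 / 3) * (1 + expTwoPi (1 / 3)) / (1 - expTwoPi (1 / 3)) ^ 3 *
      (expTwoPi (1 / 3) - (expTwoPi (1 / 3))⁻¹) ^ 3 = -1 := by
    have h0 := expTwoPi_ne_zero (1 / 3)
    have h2 : 1 - expTwoPi (1 / 3) ≠ 0 := sub_ne_zero.2 h1.symm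
    have h3 : expTwoPi (1 / 3) - (expTwoPi (1 / 3))⁻¹ =
        (1 - expTwoPi (1 / 3)) * expTwoPi (1 / 3) := by
      field_simp
      linear_combination (expTwoPi (1 / 3) - 1) * expTwoPi_third
    rw [h3]
    field_simp
    have ht := expTwoPi_third
    generalize expTwoPi (1 / 3) = ζ at *
    linear_combination (ζ ^ 3 - ζ + 1) * ht
  rw [(isTermwise_third hτ).deriv_deriv_quasiZeta hτ, add_sub_assoc, expTwoPi_neg, hL, E3_eq hτ,
    scale]
  generalize expTwoPi (1 / 3) - (expTwoPi (1 / 3))⁻¹ = δ at *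
  rw [div_pow, mul_div_assoc', div_mul_eq_mul_div, eq_div_iff (pow_ne_zero 3 hδ)]
  linear_combination (-(2 * Real.pi * I) ^ 3) * hg - (2 * Real.pi * I) ^ 3 * (∑' n : ℕ,
    (1 - expTwoPi τ ^ (n + 1))⁻¹ * ((n + 1 : ℕ) : ℂ) ^ 2 *
      ((chi3 (n + 1) : ℂ) * expTwoPi τ ^ (n + 1))) * (δ ^ 2 - 3) * hδ2

theorem E1_ne_zero {τ : ℂ} (hτ : 0 < τ.im) (h : ‖expTwoPi τ‖ ≤ 1 / 10) : E1 τ ≠ 0 := by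
  have hq := norm_expTwoPi_lt_one hτ
  have hr := norm_nonneg (expTwoPi τ)
  set r := ‖expTwoPi τ‖ with hr_def
  have hs : HasSum (fun n : ℕ => (1 - r)⁻¹ * (r * r ^ n)) ((1 - r)⁻¹ * (r * (1 - r)⁻¹)) :=
    ((hasSum_geometric_of_lt_one hr hq).mul_left r).mul_left _
  have hb := tsum_of_norm_bounded (f := fun n : ℕ => (1 - expTwoPi τ ^ (n + 1))⁻¹ *
      ((chi3 (n + 1) : ℂ) * expTwoPi τ ^ (n + 1))) hs fun n => by
    rw [norm_mul, norm_mul, norm_pow, ← hr_def, pow_succ' r]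
    have h1 := norm_inv_one_sub_pow_le hq n
    have h2 := norm_chi3_le (n + 1)
    rw [← hr_def] at h1
    exact mul_le_mul h1 (mul_le_of_le_one_left (by positivity) h2) (by positivity)
      ((norm_nonneg _).trans h1)
  have hc : (1 - r)⁻¹ ≤ 10 / 9 := by
    rw [inv_le_comm₀ (by linarith) (by norm_num)]
    linarith
  have hc0 : 0 ≤ (1 - r)⁻¹ := inv_nonneg.2 (by linarith)
  have hb2 : (1 - r)⁻¹ * (r * (1 - r)⁻¹) ≤ 10 / 9 * (1 / 10 * (10 / 9)) := by gcongr
  intro h0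
  rw [E1_eq hτ] at h0
  have h6 := congrArg norm (eq_neg_of_add_eq_zero_right h0)
  rw [norm_mul, norm_neg, norm_one, Complex.norm_ofNat] at h6
  linarith

theorem E1_eq_zero {τ : ℂ} (hτ : 0 < τ.im) (h : 3 * τ ^ 2 + 3 * τ + 1 = 0) : E1 τ = 0 := by
  have h0 := (isQuasiZeta_quasiZeta hτ).third_eq_zero_of_cube_root h
  rw [quasiZeta_third hτ] at h0
  exact (mul_eq_zero.1 h0).resolve_left scale_ne_zero

theorem two_mul_E3_eq {τ : ℂ} (hτ : 0 < τ.im) (h : 3 * τ ^ 2 + 1 = 0) (h1 : E1 τ ≠ 0) :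
    2 * E3 τ = E1 τ ^ 3 := by
  have h0 := (isQuasiZeta_quasiZeta hτ).deriv_deriv_third h
    (by rw [quasiZeta_third hτ]; exact mul_ne_zero scale_ne_zero h1)
  rw [quasiZeta_third hτ, deriv_deriv_quasiZeta_third hτ] at h0
  refine mul_left_cancel₀
    (mul_ne_zero (by norm_num : (4 : ℂ) ≠ 0) (pow_ne_zero 3 scale_ne_zero)) ?_
  linear_combination h0

theorem norm_expTwoPi_sqrt_three_div_three_le :
    ‖expTwoPi (((Real.sqrt 3 / 3 : ℝ) : ℂ) * I)‖ ≤ 1 / 10 := by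
  have hn : ‖expTwoPi (((Real.sqrt 3 / 3 : ℝ) : ℂ) * I)‖ =
      Real.exp (-(2 * Real.pi * (Real.sqrt 3 / 3))) := by
    rw [expTwoPi, norm_exp]
    congr 1
    have : (2 * Real.pi * I * (((Real.sqrt 3 / 3 : ℝ) : ℂ) * I)) =
        ((-(2 * Real.pi * (Real.sqrt 3 / 3)) : ℝ) : ℂ) := by
      push_cast
      linear_combination (2 * Real.pi * (Real.sqrt 3 / 3) : ℂ) * I_sq
    rw [this, ofReal_re]
  have hs : 3 / 2 ≤ Real.sqrt 3 := Real.le_sqrt_of_sq_le (by norm_num)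
  have h3 : 3 ≤ 2 * Real.pi * (Real.sqrt 3 / 3) := by nlinarith [Real.pi_gt_three]
  have he : (10 : ℝ) ≤ Real.exp 3 := by
    have h := Real.exp_one_gt_d9
    calc (10 : ℝ) ≤ 2.7 ^ 3 := by norm_num
      _ ≤ Real.exp 1 ^ 3 := by gcongr; linarith
      _ = Real.exp 3 := by rw [← Real.exp_nat_mul]; norm_num
  rw [hn, Real.exp_neg, one_div]
  exact inv_anti₀ (by norm_num) (he.trans (Real.exp_le_exp.2 h3))

end EisensteinThree

/-- `E₁` vanishes at the elliptic point `−1/2 + (√3/6)i`, and `κ = 2E₃ − E₁³` vanishes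
at `(√3/3)i`. -/
theorem statement17 :
    E1 (-(1 / 2 : ℂ) + (Real.sqrt 3 / 6 : ℝ) * Complex.I) = 0 ∧
    2 * E3 (((Real.sqrt 3 / 3 : ℝ) : ℂ) * Complex.I)
      = E1 (((Real.sqrt 3 / 3 : ℝ) : ℂ) * Complex.I) ^ 3 := by
  have h3 : ((Real.sqrt 3 : ℝ) : ℂ) ^ 2 = 3 := by
    rw [← Complex.ofReal_pow, Real.sq_sqrt (by norm_num)]; norm_num
  constructor
  · refine EisensteinThree.E1_eq_zero (by simp) ?_
    push_cast
    linear_combination (Complex.I ^ 2 / 12) * h3 + (1 / 4 : ℂ) * Complex.I_sq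
  · have hτ : 0 < (((Real.sqrt 3 / 3 : ℝ) : ℂ) * Complex.I).im := by simp
    refine EisensteinThree.two_mul_E3_eq hτ ?_ (EisensteinThree.E1_ne_zero hτ
      EisensteinThree.norm_expTwoPi_sqrt_three_div_three_le)
    push_cast
    linear_combination (Complex.I ^ 2 / 3) * h3 + Complex.I_sq
end
end

section
/- Let R = ℤ[1/6][G₂,G₃,G₄] and let S = R[u,v]/(v³ − (1 + G₂u⁶ + G₃u⁹ + G₄u¹²)) be the coordinate ring of the chart at infinity of the Picard curve y³ = x⁴ + G₂x² + G₃x + G₄ (via x = u⁻³, y = v·u⁻⁴). Then the ideal P = (u, v − 1) of S is prime, and in the localization S_P the maximal ideal is generated by the image of u; that is, u is a local parameter at the point at infinity of the Picard curve (in particular v − 1 lies in the ideal generated by u in S_P, indeed in the ideal generated by u³). -/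
noncomputable section

set_option maxSynthPendingDepth 3

/-- The ring `ℤ[1/6]`, as a subring of `ℚ`. -/
def Z16 : Subring ℚ := Subring.closure {(1 : ℚ) / 6}

/-- The base ring `R = ℤ[1/6][G₂,G₃,G₄]`. -/
abbrev Rbase : Type := MvPolynomial (Fin 3) Z16

/-- The coordinate ring `R[u,v]` (with `u = X 0`, `v = X 1`). -/
abbrev Ruv : Type := MvPolynomial (Fin 2) Rbase

/-- The element `G₂` of `R[u,v]`. -/
def G2uv : Ruv := MvPolynomial.C (MvPolynomial.X 0)

/-- The element `G₃` of `R[u,v]`. -/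
def G3uv : Ruv := MvPolynomial.C (MvPolynomial.X 1)

/-- The element `G₄` of `R[u,v]`. -/
def G4uv : Ruv := MvPolynomial.C (MvPolynomial.X 2)

/-- The variable `u`. -/
def uVar : Ruv := MvPolynomial.X 0

/-- The variable `v`. -/
def vVar : Ruv := MvPolynomial.X 1

/-- The defining equation `v³ − (1 + G₂u⁶ + G₃u⁹ + G₄u¹²)` of the chart at infinity of
the Picard curve `y³ = x⁴ + G₂x² + G₃x + G₄` (via `x = u⁻³`, `y = v·u⁻⁴`). -/
def curveRel : Ruv :=
  vVar ^ 3 - (1 + G2uv * uVar ^ 6 + G3uv * uVar ^ 9 + G4uv * uVar ^ 12)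

/-- The ideal generated by the curve relation. -/
def curveIdeal : Ideal Ruv := Ideal.span {curveRel}

/-- The coordinate ring `S = R[u,v]/(v³ − (1 + G₂u⁶ + G₃u⁹ + G₄u¹²))`. -/
abbrev Scurve : Type := Ruv ⧸ curveIdeal

/-- The image of `u` in `S`. -/
def uS : Scurve := Ideal.Quotient.mk curveIdeal uVar

/-- The image of `v` in `S`. -/
def vS : Scurve := Ideal.Quotient.mk curveIdeal vVar

/-- The ideal `P = (u, v − 1)` of `S`, corresponding to the point at infinity. -/
def Pinf : Ideal Scurve := Ideal.span {uS, vS - 1}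

/-- If `a * t = u ^ n * w` with `t ∉ P`, then `a` is a multiple of `u ^ n` in the localization
at `P`. -/
theorem algebraMap_mem_span_pow_of_mul_eq {A : Type*} [CommRing A] (P : Ideal A) [P.IsPrime]
    {n : ℕ} {a t u w : A} (h : a * t = u ^ n * w) (ht : t ∉ P) :
    algebraMap A (Localization P.primeCompl) a ∈
      Ideal.span {algebraMap A (Localization P.primeCompl) u ^ n} := by
  have hu : IsUnit (algebraMap A (Localization P.primeCompl) t) :=
    IsLocalization.map_units (Localization P.primeCompl) (⟨t, ht⟩ : P.primeCompl)
  rw [← Ideal.mul_unit_mem_iff_mem _ hu, ← map_mul, h, map_mul, map_pow]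
  exact Ideal.mul_mem_right _ _ (Ideal.mem_span_singleton_self _)

/-- A polynomial in two variables is congruent to its value at `(a, b)` modulo
`(X 0 - a, X 1 - b)`. -/
theorem MvPolynomial.sub_C_eval_mem_span {A : Type*} [CommRing A] (a b : A)
    (p : MvPolynomial (Fin 2) A) :
    p - C (eval ![a, b] p) ∈ Ideal.span {X 0 - C a, X 1 - C b} := by
  rw [← Ideal.Quotient.eq]
  induction p using MvPolynomial.induction_on with
  | C r => simp
  | add p q hp hq => simp only [map_add, hp, hq]
  | mul_X p i hp =>
    have hX : Ideal.Quotient.mk (Ideal.span {X 0 - C a, X 1 - C b}) (X i) =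
        Ideal.Quotient.mk _ (C (![a, b] i)) := by
      rw [Ideal.Quotient.eq]
      apply Ideal.subset_span
      fin_cases i <;> simp
    simp only [map_mul, hp, eval_X, hX]

/-- Evaluation of functions on the curve at the point at infinity `(u, v) = (0, 1)`. -/
def evalInf : Scurve →+* Rbase :=
  Ideal.Quotient.lift curveIdeal (MvPolynomial.eval ![0, 1]) <| by
    change curveIdeal ≤ RingHom.ker _
    rw [curveIdeal, Ideal.span_singleton_le_iff_mem, RingHom.mem_ker]
    simp [curveRel, uVar, vVar]

theorem evalInf_uS : evalInf uS = 0 := by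
  simp [evalInf, uS, uVar]

theorem evalInf_vS : evalInf vS = 1 := by
  simp [evalInf, vS, vVar]

theorem ker_evalInf : RingHom.ker evalInf = Pinf := by
  apply le_antisymm
  · intro s hs
    obtain ⟨p, rfl⟩ := Ideal.Quotient.mk_surjective s
    have hp : MvPolynomial.eval ![0, 1] p = 0 := by simpa [evalInf] using hs
    have h := MvPolynomial.sub_C_eval_mem_span 0 1 p
    rw [hp, map_zero, sub_zero] at h
    have h' := Ideal.mem_map_of_mem (Ideal.Quotient.mk curveIdeal) h
    simpa [Ideal.map_span, Set.image_pair, Pinf, uS, vS, uVar, vVar] using h'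
  · rw [Pinf, Ideal.span_le]
    rintro s (rfl | rfl)
    · exact evalInf_uS
    · change evalInf (vS - 1) = 0
      rw [map_sub, evalInf_vS, map_one, sub_self]

theorem isPrime_Pinf : Pinf.IsPrime :=
  ker_evalInf ▸ RingHom.ker_isPrime evalInf

theorem vS_sub_one_mul : ∃ w : Scurve, (vS - 1) * (vS ^ 2 + vS + 1) = uS ^ 3 * w := by
  refine ⟨Ideal.Quotient.mk curveIdeal (G2uv * uVar ^ 3 + G3uv * uVar ^ 6 + G4uv * uVar ^ 9), ?_⟩
  have h : Ideal.Quotient.mk curveIdeal ((vVar - 1) * (vVar ^ 2 + vVar + 1)) =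
      Ideal.Quotient.mk curveIdeal
        (uVar ^ 3 * (G2uv * uVar ^ 3 + G3uv * uVar ^ 6 + G4uv * uVar ^ 9)) := by
    rw [Ideal.Quotient.eq]
    refine Ideal.mem_span_singleton.2 (dvd_of_eq ?_)
    rw [curveRel]
    ring
  simpa only [map_mul, map_add, map_sub, map_pow, map_one, uS, vS] using h

theorem vS_sq_add_vS_add_one_notMem : vS ^ 2 + vS + 1 ∉ Pinf := by
  rw [← ker_evalInf, RingHom.mem_ker, map_add, map_add, map_pow, evalInf_vS, map_one]
  norm_num

/-- The ideal `P = (u, v−1)` of `S` is prime, and in the localization `S_P` the maximal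
ideal (the image of `P`) is generated by `u`; moreover `v − 1` lies in the ideal of `S_P`
generated by `u` — indeed in the one generated by `u³`. Thus `u` is a local parameter at
the point at infinity of the Picard curve. -/
theorem statement18 :
    Pinf.IsPrime ∧
    ∀ (hP : Pinf.IsPrime),
      (Ideal.map (algebraMap Scurve (Localization (@Ideal.primeCompl Scurve _ Pinf hP)))
          Pinf
        = Ideal.span {algebraMap Scurve
            (Localization (@Ideal.primeCompl Scurve _ Pinf hP)) uS}) ∧
      algebraMap Scurve (Localization (@Ideal.primeCompl Scurve _ Pinf hP)) (vS - 1) ∈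
        Ideal.span {(algebraMap Scurve
          (Localization (@Ideal.primeCompl Scurve _ Pinf hP)) uS) ^ 3} ∧
      algebraMap Scurve (Localization (@Ideal.primeCompl Scurve _ Pinf hP)) (vS - 1) ∈
        Ideal.span {algebraMap Scurve
          (Localization (@Ideal.primeCompl Scurve _ Pinf hP)) uS} := by
  refine ⟨isPrime_Pinf, fun hP => ?_⟩
  obtain ⟨w, hw⟩ := vS_sub_one_mul
  have h3 := algebraMap_mem_span_pow_of_mul_eq Pinf hw vS_sq_add_vS_add_one_notMem
  have h1 := Ideal.span_singleton_le_span_singleton.2 (dvd_pow_self _ three_ne_zero) h3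
  refine ⟨le_antisymm ?_ ?_, h3, h1⟩
  · rw [Ideal.map_le_iff_le_comap]
    refine Ideal.span_le.2 ?_
    rintro s (rfl | rfl)
    · exact Ideal.mem_span_singleton_self _
    · exact h1
  · rw [Ideal.span_singleton_le_iff_mem]
    exact Ideal.mem_map_of_mem _ (Ideal.subset_span (Set.mem_insert _ _))
end
end
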